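/- Let f be an endomorphism of A₁ with P = f(X) and Q = f(Y). If at least one of the following holds: α(P) = P, or α(P) = −P, or α(Q) = Q, or α(Q) = −Q (i.e., P or Q is symmetric or skew-symmetric with respect to the exchange involution α), then f is an automorphism of A₁. -/

import Mathlib

noncomputable section

/-- `f : A → A` is a `K`-algebra endomorphism (as a bare function). -/
def IsAlgEndo (K : Type) [CommSemiring K] {A : Type} [Semiring A] [Algebra K A]
    (f : A → A) : Prop :=
  (∀ a b : A, f (a + b) = f a + f b) ∧
  (∀ (c : K) (a : A), f (c • a) = c • f a) ∧
  (∀ a b : A, f (a * b) = f a * f b) ∧ f 1 = 1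

/-- `f : A → A` is a `K`-algebra automorphism: a bijective endomorphism. -/
def IsAlgAuto (K : Type) [CommSemiring K] {A : Type} [Semiring A] [Algebra K A]
    (f : A → A) : Prop :=
  IsAlgEndo K f ∧ Function.Bijective f

/-- `f : A → A` is a `K`-linear anti-endomorphism. -/
def IsAntiEndo (K : Type) [CommSemiring K] {A : Type} [Semiring A] [Algebra K A]
    (f : A → A) : Prop :=
  (∀ a b : A, f (a + b) = f a + f b) ∧
  (∀ (c : K) (a : A), f (c • a) = c • f a) ∧
  (∀ a b : A, f (a * b) = f b * f a) ∧ f 1 = 1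

/-- `f : A → A` is an anti-automorphism: a bijective anti-endomorphism. -/
def IsAntiAuto (K : Type) [CommSemiring K] {A : Type} [Semiring A] [Algebra K A]
    (f : A → A) : Prop :=
  IsAntiEndo K f ∧ Function.Bijective f

/-- An involution on a `K`-algebra: an anti-automorphism of order at most two. -/
def IsInvolutionOn (K : Type) [CommSemiring K] {A : Type} [Semiring A] [Algebra K A]
    (γ : A → A) : Prop :=
  IsAntiAuto K γ ∧ γ ∘ γ = id

/-- The defining relation of the first Weyl algebra: `Y*X = X*Y + 1`. -/
inductive WeylRel (K : Type) [CommSemiring K] :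
    FreeAlgebra K (Fin 2) → FreeAlgebra K (Fin 2) → Prop
  | rel : WeylRel K (FreeAlgebra.ι K 1 * FreeAlgebra.ι K 0)
      (FreeAlgebra.ι K 0 * FreeAlgebra.ι K 1 + 1)

/-- The first Weyl algebra `A₁(K) = K⟨X,Y⟩/(YX - XY - 1)`. -/
abbrev Weyl (K : Type) [CommSemiring K] : Type := RingQuot (WeylRel K)

/-- The generator `X` of the Weyl algebra. -/
def Wx (K : Type) [CommSemiring K] : Weyl K :=
  RingQuot.mkAlgHom K (WeylRel K) (FreeAlgebra.ι K 0)

/-- The generator `Y` of the Weyl algebra. -/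
def Wy (K : Type) [CommSemiring K] : Weyl K :=
  RingQuot.mkAlgHom K (WeylRel K) (FreeAlgebra.ι K 1)

/-- `α` is the exchange involution: the involution with `α X = Y` and `α Y = X`. -/
def IsExchange (K : Type) [CommSemiring K] (α : Weyl K → Weyl K) : Prop :=
  IsInvolutionOn K α ∧ α (Wx K) = Wy K ∧ α (Wy K) = Wx K

/-- `γ` is conjugate to `α` by an automorphism or an anti-automorphism:
`γ = g⁻¹ ∘ α ∘ g`. -/
def ConjToAlpha (K : Type) [CommSemiring K] (α γ : Weyl K → Weyl K) : Prop :=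
  ∃ g : Weyl K → Weyl K, (IsAlgAuto K g ∨ IsAntiAuto K g) ∧
    γ = Function.invFun g ∘ α ∘ g

noncomputable section
open Polynomial

namespace WW

section basic
variable (R : Type) [CommRing R]

theorem wrel : Wy R * Wx R = Wx R * Wy R + 1 := by
  have h := RingQuot.mkAlgHom_rel R (WeylRel.rel (K := R))
  simpa [Wx, Wy, map_mul, map_add] using h

theorem ind {C : Weyl R → Prop} (hr : ∀ r : R, C (algebraMap R (Weyl R) r))
    (hx : C (Wx R)) (hy : C (Wy R)) (hm : ∀ a b, C a → C b → C (a * b))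
    (ha : ∀ a b, C a → C b → C (a + b)) (z : Weyl R) : C z := by
  obtain ⟨w, rfl⟩ := RingQuot.mkAlgHom_surjective R (WeylRel R) z
  induction w using FreeAlgebra.induction with
  | grade0 r => simpa using hr r
  | grade1 i =>
    fin_cases i
    · exact hx
    · exact hy
  | mul a b h1 h2 => rw [map_mul]; exact hm _ _ h1 h2
  | add a b h1 h2 => rw [map_add]; exact ha _ _ h1 h2

variable {R} in
/-- universal property -/
def wlift {S : Type} [Ring S] [Algebra R S] (x y : S) (h : y * x = x * y + 1) : Weyl R →ₐ[R] S :=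
  RingQuot.liftAlgHom R ⟨FreeAlgebra.lift R ![x, y], by
    intro a b hab
    cases hab
    simpa using h⟩

variable {R} in
@[simp] theorem wlift_x {S : Type} [Ring S] [Algebra R S] (x y : S) (h : y * x = x * y + 1) :
    wlift (R := R) x y h (Wx R) = x := by
  simp [wlift, Wx]

variable {R} in
@[simp] theorem wlift_y {S : Type} [Ring S] [Algebra R S] (x y : S) (h : y * x = x * y + 1) :
    wlift (R := R) x y h (Wy R) = y := by
  simp [wlift, Wy]

theorem whom_ext {S : Type} [Ring S] [Algebra R S] {f g : Weyl R →ₐ[R] S}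
    (h1 : f (Wx R) = g (Wx R)) (h2 : f (Wy R) = g (Wy R)) : f = g := by
  apply AlgHom.ext
  intro z
  induction z using ind R with
  | hr r => simp
  | hx => exact h1
  | hy => exact h2
  | hm a b h1 h2 => simp [h1, h2]
  | ha a b h1 h2 => simp [h1, h2]

/-- differential operator representation -/
def rho : Weyl R →ₐ[R] Module.End R[X] (R[X][X]) :=
  wlift (LinearMap.mulLeft R[X] (X : R[X][X]))
    (LinearMap.mulLeft R[X] (C X : R[X][X]) + derivative) (by
      apply LinearMap.ext
      intro f
      simp
      ring)

@[simp] theorem rho_x (f : R[X][X]) : rho R (Wx R) f = X * f := by simp [rho]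
@[simp] theorem rho_y (f : R[X][X]) : rho R (Wy R) f = C X * f + derivative f := by simp [rho]

/-- normal symbol -/
def sym : Weyl R →ₗ[R] R[X][X] where
  toFun z := rho R z 1
  map_add' a b := by simp
  map_smul' r a := by simp

theorem sym_def (z : Weyl R) : sym R z = rho R z 1 := rfl
theorem sym_mul (a b : Weyl R) : sym R (a * b) = rho R a (sym R b) := by
  simp [sym_def]
@[simp] theorem sym_one : sym R 1 = 1 := by simp [sym_def]
@[simp] theorem sym_x : sym R (Wx R) = X := by simp [sym_def]
@[simp] theorem sym_y : sym R (Wy R) = C X := by simp [sym_def]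
theorem sym_x_mul (z : Weyl R) : sym R (Wx R * z) = X * sym R z := by simp [sym_mul]
theorem sym_y_mul (z : Weyl R) : sym R (Wy R * z) = C X * sym R z + derivative (sym R z) := by
  simp [sym_mul]
theorem sym_mul_y (z : Weyl R) : sym R (z * Wy R) = C X * sym R z := by
  rw [sym_mul, sym_y, sym_def]
  have := (rho R z).map_smul (X : R[X]) 1
  rw [smul_eq_C_mul, smul_eq_C_mul, mul_one] at this
  exact this

/-- inverse of the symbol map -/
def ofSym : R[X][X] →ₗ[R] Weyl R :=
  Polynomial.lsum (fun i => (LinearMap.mulLeft R (Wx R ^ i)).comp (aeval (Wy R)).toLinearMap)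

theorem ofSym_monomial (i : ℕ) (a : R[X]) : ofSym R (monomial i a) = Wx R ^ i * aeval (Wy R) a := by
  simp [ofSym, Polynomial.lsum]

theorem y_mul_x_pow (i : ℕ) : Wy R * Wx R ^ i = Wx R ^ i * Wy R + (i : Weyl R) * Wx R ^ (i - 1) := by
  induction i with
  | zero => simp
  | succ n ih =>
    rw [pow_succ, ← mul_assoc, ih]
    rcases n with _ | n
    · simp [wrel]
    · simp only [Nat.add_sub_cancel, add_mul, mul_assoc, wrel, mul_add, mul_one, ← pow_succ]
      push_cast
      noncomm_ring

theorem ofSym_rho (z : Weyl R) : ∀ f, ofSym R (rho R z f) = z * ofSym R f := by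
  induction z using ind R with
  | hr r => 
    intro f
    rw [AlgHom.commutes, ← Algebra.smul_def, ← map_smul]
    rfl
  | hx =>
    intro f
    induction f using Polynomial.induction_on' with
    | add p q hp hq => simp only [map_add, hp, hq, mul_add]
    | monomial n a =>
      rw [rho_x, X_mul_monomial, ofSym_monomial, ofSym_monomial, pow_succ', mul_assoc]
  | hy =>
    intro f
    induction f using Polynomial.induction_on' with
    | add p q hp hq => simp only [map_add, hp, hq, mul_add]
    | monomial n a =>
      rw [rho_y, C_mul_monomial, map_add, derivative_monomial, ofSym_monomial, ofSym_monomial,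
        ofSym_monomial, ← mul_assoc, y_mul_x_pow, add_mul, mul_assoc, map_mul, map_mul, aeval_X,
        map_natCast]
      congr 1
      rw [mul_assoc, (Nat.cast_commute n _).eq, mul_assoc]
  | hm a b h1 h2 => intro f; simp [h1, h2, mul_assoc]
  | ha a b h1 h2 => intro f; simp [h1, h2, add_mul]

theorem ofSym_sym (z : Weyl R) : ofSym R (sym R z) = z := by
  rw [sym_def, ofSym_rho]
  have := ofSym_monomial R 0 1
  simp at this
  rw [this, mul_one]

theorem sym_inj {a b : Weyl R} (h : sym R a = sym R b) : a = b := by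
  rw [← ofSym_sym R a, h, ofSym_sym]

theorem rho_x_pow (n : ℕ) (f : R[X][X]) : rho R (Wx R ^ n) f = X ^ n * f := by
  induction n with
  | zero => simp
  | succ n ih => rw [pow_succ', map_mul, Module.End.mul_apply, ih, rho_x, pow_succ']; ring

theorem sym_mul_y_pow (z : Weyl R) (n : ℕ) : sym R (z * Wy R ^ n) = C X ^ n * sym R z := by
  induction n with
  | zero => simp
  | succ n ih => rw [pow_succ, ← mul_assoc, sym_mul_y, ih, pow_succ]; ring

theorem sym_mon (i j : ℕ) : sym R (Wx R ^ i * Wy R ^ j) = C X ^ j * X ^ i := by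
  rw [sym_mul_y_pow, sym_def, rho_x_pow, mul_one]

theorem sym_aeval_y (a : R[X]) : sym R (aeval (Wy R) a) = C a := by
  induction a using Polynomial.induction_on' with
  | add p q hp hq => simp only [map_add, hp, hq]
  | monomial n a =>
    have := sym_mon R 0 n
    simp only [pow_zero, one_mul, mul_one] at this
    rw [aeval_monomial, ← Algebra.smul_def, map_smul, this, ← C_mul_X_pow_eq_monomial]
    simp [Algebra.smul_def]

theorem sym_ofSym (f : R[X][X]) : sym R (ofSym R f) = f := by
  induction f using Polynomial.induction_on' with
  | add p q hp hq => simp only [map_add, hp, hq]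
  | monomial n a =>
    rw [ofSym_monomial, sym_mul, rho_x_pow, sym_aeval_y, X_pow_mul_C, C_mul_X_pow_eq_monomial]

/-- coefficient of `u^i v^j` -/
def cf (z : Weyl R) (i j : ℕ) : R := ((sym R z).coeff i).coeff j

variable {R}
theorem cf_ext {a b : Weyl R} (h : ∀ i j, cf R a i j = cf R b i j) : a = b :=
  sym_inj R (by ext i j; exact h i j)

end basic
end WW

end

noncomputable section
open Polynomial

namespace WW

section degs
variable {R : Type} [CommRing R]

theorem cf_add (a b : Weyl R) (i j : ℕ) : cf R (a + b) i j = cf R a i j + cf R b i j := by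
  simp [cf]
theorem cf_sub (a b : Weyl R) (i j : ℕ) : cf R (a - b) i j = cf R a i j - cf R b i j := by
  simp [cf]
theorem cf_neg (a : Weyl R) (i j : ℕ) : cf R (-a) i j = - cf R a i j := by
  simp [cf]
theorem cf_smul (r : R) (a : Weyl R) (i j : ℕ) : cf R (r • a) i j = r * cf R a i j := by
  simp [cf]
theorem cf_zero (i j : ℕ) : cf R (0 : Weyl R) i j = 0 := by
  simp [cf]
theorem cf_sum {ι : Type} (s : Finset ι) (f : ι → Weyl R) (i j : ℕ) :
    cf R (∑ t ∈ s, f t) i j = ∑ t ∈ s, cf R (f t) i j := by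
  simp [cf, map_sum]
theorem cf_mon (a b i j : ℕ) :
    cf R (Wx R ^ a * Wy R ^ b) i j = if i = a ∧ j = b then 1 else 0 := by
  rw [cf, sym_mon, ← C_pow, coeff_C_mul, coeff_X_pow]
  by_cases h : i = a <;> simp [h, coeff_X_pow]

theorem expand (z : Weyl R) (M N : ℕ) (h : ∀ i j, M ≤ i ∨ N ≤ j → cf R z i j = 0) :
    z = ∑ i ∈ Finset.range M, ∑ j ∈ Finset.range N, cf R z i j • (Wx R ^ i * Wy R ^ j) := by
  apply cf_ext
  intro a b
  simp only [cf_sum, cf_smul, cf_mon]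
  by_cases hh : M ≤ a ∨ N ≤ b
  · rw [h a b hh, eq_comm]
    refine Finset.sum_eq_zero fun i hi => Finset.sum_eq_zero fun j hj => ?_
    rw [if_neg, mul_zero]
    rintro ⟨rfl, rfl⟩
    simp at hi hj
    omega
  · push Not at hh
    rw [Finset.sum_eq_single_of_mem a (by simp [hh]), Finset.sum_eq_single_of_mem b (by simp [hh])]
    · simp
    · intro j _ hj; simp [hj.symm]
    · intro i _ hi
      refine Finset.sum_eq_zero fun j hj => ?_
      simp [hi.symm]

theorem exists_bd (z : Weyl R) : ∃ D, ∀ i j, D ≤ i ∨ D ≤ j → cf R z i j = 0 := by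
  refine ⟨(sym R z).natDegree + 1 +
    ∑ i ∈ Finset.range ((sym R z).natDegree + 1), (((sym R z).coeff i).natDegree + 1), ?_⟩
  intro i j h
  rw [cf]
  by_cases hi : (sym R z).natDegree < i
  · rw [coeff_eq_zero_of_natDegree_lt hi]; simp
  · apply coeff_eq_zero_of_natDegree_lt
    have hm : i ∈ Finset.range ((sym R z).natDegree + 1) := by simp; omega
    have := Finset.single_le_sum (f := fun i => (((sym R z).coeff i).natDegree + 1))
      (fun _ _ => Nat.zero_le _) hm
    omega

theorem lin_ind {C : Weyl R → Prop} (h0 : C 0) (ha : ∀ a b, C a → C b → C (a + b))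
    (hs : ∀ (r : R) a, C a → C (r • a)) (hm : ∀ i j, C (Wx R ^ i * Wy R ^ j)) (z : Weyl R) : C z := by
  obtain ⟨D, hD⟩ := exists_bd z
  rw [expand z D D hD]
  exact Finset.sum_induction _ C ha h0 fun i _ =>
    Finset.sum_induction _ C ha h0 fun j _ => hs _ _ (hm i j)

theorem cf_x_mul_zero (z : Weyl R) (j : ℕ) : cf R (Wx R * z) 0 j = 0 := by
  simp [cf, sym_x_mul]
theorem cf_x_mul (z : Weyl R) (i j : ℕ) : cf R (Wx R * z) (i + 1) j = cf R z i j := by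
  simp [cf, sym_x_mul]
theorem cf_mul_y_zero (z : Weyl R) (i : ℕ) : cf R (z * Wy R) i 0 = 0 := by
  simp [cf, sym_mul_y]
theorem cf_mul_y (z : Weyl R) (i j : ℕ) : cf R (z * Wy R) i (j + 1) = cf R z i j := by
  simp [cf, sym_mul_y]

theorem cf_comm_y (z : Weyl R) (i j : ℕ) :
    cf R (Wy R * z - z * Wy R) i j = (i + 1) * cf R z (i + 1) j := by
  rw [cf, map_sub, sym_y_mul, sym_mul_y, add_sub_cancel_left, coeff_derivative, cf, mul_comm]
  norm_cast
  rw [← C_eq_natCast, coeff_C_mul]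

theorem y_pow_mul_x (b : ℕ) :
    Wy R ^ b * Wx R = Wx R * Wy R ^ b + (b : R) • Wy R ^ (b - 1) := by
  induction b with
  | zero => simp
  | succ n ih =>
    rw [pow_succ', mul_assoc, ih]
    rcases n with _ | n
    · simp [wrel]
    · simp only [Nat.add_sub_cancel, mul_add, ← mul_assoc, wrel, add_mul, one_mul,
        mul_smul_comm, ← pow_succ']
      rw [add_assoc, mul_assoc, ← pow_succ']
      congr 1
      push_cast
      module

theorem cf_comm_x (z : Weyl R) : ∀ (i j : ℕ),
    cf R (z * Wx R - Wx R * z) i j = (j + 1) * cf R z i (j + 1) := by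
  induction z using lin_ind with
  | h0 => simp [cf_zero]
  | ha a b h1 h2 =>
    intro i j
    rw [cf_add a b i (j + 1), mul_add (_ : R), ← h1, ← h2, ← cf_add]; congr 1; noncomm_ring
  | hs r a h =>
    intro i j
    rw [cf_smul, mul_left_comm, ← h, ← cf_smul]; congr 1
    simp [smul_sub]
  | hm a b =>
    intro i j
    have : Wx R ^ a * Wy R ^ b * Wx R - Wx R * (Wx R ^ a * Wy R ^ b) =
       (b : R) • (Wx R ^ a * Wy R ^ (b - 1)) := by
      rw [mul_assoc, y_pow_mul_x, mul_add, ← mul_assoc, ← mul_assoc, ← pow_succ, ← pow_succ',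
        add_sub_cancel_left, mul_smul_comm]
    rw [this, cf_smul, cf_mon, cf_mon]
    rcases b with _ | b
    · simp
    · by_cases h : i = a ∧ j = b
      · simp [h]
      · rw [if_neg, if_neg]
        · simp
        · omega
        · simpa using h

/-- bounded in u-degree by m and v-degree by n -/
def Bd (m n : ℕ) (z : Weyl R) : Prop := ∀ i j, m < i ∨ n < j → cf R z i j = 0

theorem Bd.mono {m n m' n' : ℕ} {z : Weyl R} (h : Bd m n z) (hm : m ≤ m') (hn : n ≤ n') :
    Bd m' n' z := fun i j hij => h i j (by omega)
theorem Bd.add {m n : ℕ} {a b : Weyl R} (h : Bd m n a) (h' : Bd m n b) : Bd m n (a + b) :=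
  fun i j hij => by rw [cf_add, h i j hij, h' i j hij, add_zero]
theorem Bd.sub {m n : ℕ} {a b : Weyl R} (h : Bd m n a) (h' : Bd m n b) : Bd m n (a - b) :=
  fun i j hij => by rw [cf_sub, h i j hij, h' i j hij, sub_zero]
theorem Bd.smul {m n : ℕ} {a : Weyl R} (r : R) (h : Bd m n a) : Bd m n (r • a) :=
  fun i j hij => by rw [cf_smul, h i j hij, mul_zero]
theorem Bd.zero {m n : ℕ} : Bd m n (0 : Weyl R) := fun i j _ => cf_zero i j
theorem Bd.one {m n : ℕ} : Bd m n (1 : Weyl R) := fun i j hij => by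
  have := cf_mon (R := R) 0 0 i j
  simp only [pow_zero, mul_one] at this
  rw [this, if_neg]; omega
theorem Bd.sum {m n : ℕ} {ι : Type} {s : Finset ι} {f : ι → Weyl R} (h : ∀ t ∈ s, Bd m n (f t)) :
    Bd m n (∑ t ∈ s, f t) :=
  fun i j hij => by rw [cf_sum]; exact Finset.sum_eq_zero fun t ht => h t ht i j hij

theorem Bd.x_mul {m n : ℕ} {z : Weyl R} (h : Bd m n z) : Bd (m + 1) n (Wx R * z) := by
  rintro (_ | i) j hij
  · exact cf_x_mul_zero z j
  · rw [cf_x_mul]; exact h _ _ (by omega)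
theorem Bd.mul_y {m n : ℕ} {z : Weyl R} (h : Bd m n z) : Bd m (n + 1) (z * Wy R) := by
  rintro i (_ | j) hij
  · exact cf_mul_y_zero z i
  · rw [cf_mul_y]; exact h _ _ (by omega)
theorem Bd.y_mul {m n : ℕ} {z : Weyl R} (h : Bd m n z) : Bd m (n + 1) (Wy R * z) := by
  have : Wy R * z = (Wy R * z - z * Wy R) + z * Wy R := by abel
  rw [this]
  refine Bd.add ?_ h.mul_y
  intro i j hij
  rw [cf_comm_y, h _ _ (by omega), mul_zero]

theorem Bd.x_pow_mul {m n : ℕ} {z : Weyl R} (h : Bd m n z) (k : ℕ) :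
    Bd (m + k) n (Wx R ^ k * z) := by
  induction k with
  | zero => simpa using h
  | succ k ih => rw [pow_succ', mul_assoc]; exact ih.x_mul
theorem Bd.y_pow_mul {m n : ℕ} {z : Weyl R} (h : Bd m n z) (k : ℕ) :
    Bd m (n + k) (Wy R ^ k * z) := by
  induction k with
  | zero => simpa using h
  | succ k ih => rw [pow_succ', mul_assoc]; exact ih.y_mul

theorem Bd.expand {m n : ℕ} {z : Weyl R} (h : Bd m n z) :
    z = ∑ i ∈ Finset.range (m + 1), ∑ j ∈ Finset.range (n + 1),
      cf R z i j • (Wx R ^ i * Wy R ^ j) :=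
  WW.expand z _ _ fun i j hij => h i j (by omega)

theorem Bd.mul {m n m' n' : ℕ} {a b : Weyl R} (ha : Bd m n a) (hb : Bd m' n' b) :
    Bd (m + m') (n + n') (a * b) := by
  rw [ha.expand, Finset.sum_mul]
  refine Bd.sum fun i hi => ?_
  rw [Finset.sum_mul]
  refine Bd.sum fun j hj => ?_
  rw [smul_mul_assoc, mul_assoc]
  simp only [Finset.mem_range] at hi hj
  exact (((hb.y_pow_mul j).x_pow_mul i).smul _).mono (by omega) (by omega)

theorem Bd.pow {m n : ℕ} {a : Weyl R} (ha : Bd m n a) (k : ℕ) : Bd (k * m) (k * n) (a ^ k) := by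
  induction k with
  | zero => simpa using Bd.one
  | succ k ih => rw [pow_succ]; exact (ih.mul ha).mono (by linarith) (by linarith)

/-- coefficient polynomial of `u^i` -/
def uc (z : Weyl R) (i : ℕ) : R[X] := (sym R z).coeff i

theorem uc_eq_zero {m n : ℕ} {z : Weyl R} (h : Bd m n z) {i : ℕ} (hi : m < i) : uc z i = 0 := by
  ext j; exact h i j (Or.inl hi)

theorem uc_x_pow_mul (z : Weyl R) (k i : ℕ) : uc (Wx R ^ k * z) (i + k) = uc z i := by
  rw [uc, sym_mul, rho_x_pow, add_comm, add_comm k i, coeff_X_pow_mul]; rfl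

theorem uc_y_pow_mul {m n : ℕ} {z : Weyl R} (h : Bd m n z) (k : ℕ) :
    uc (Wy R ^ k * z) m = X ^ k * uc z m := by
  induction k with
  | zero => simp
  | succ k ih =>
    rw [pow_succ', mul_assoc]
    have h1 : uc (Wy R * (Wy R ^ k * z)) m =
      X * uc (Wy R ^ k * z) m + uc (Wy R ^ k * z) (m + 1) * ((m : R[X]) + 1) := by
      simp only [uc]
      rw [sym_y_mul, coeff_add, coeff_C_mul, coeff_derivative]
    rw [h1, uc_eq_zero (h.y_pow_mul k) (Nat.lt_succ_self m), ih]
    ring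

theorem uc_sum {ι : Type} (s : Finset ι) (f : ι → Weyl R) (i : ℕ) :
    uc (∑ t ∈ s, f t) i = ∑ t ∈ s, uc (f t) i := by
  simp [uc, map_sum]
theorem uc_smul (r : R) (a : Weyl R) (i : ℕ) : uc (r • a) i = C r * uc a i := by
  simp [uc, smul_eq_C_mul]

theorem uc_mul {m n m' n' : ℕ} {a b : Weyl R} (ha : Bd m n a) (hb : Bd m' n' b) :
    uc (a * b) (m + m') = uc a m * uc b m' := by
  conv_lhs => rw [ha.expand, Finset.sum_mul, uc_sum, Finset.sum_range_succ]
  rw [Finset.sum_eq_zero, zero_add]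
  · rw [Finset.sum_mul, uc_sum]
    have : uc a m = ∑ j ∈ Finset.range (n + 1), C (cf R a m j) * X ^ j := by
      have h := Polynomial.as_sum_range' (uc a m) (n + 1) (by
        rw [Nat.lt_succ_iff, natDegree_le_iff_coeff_eq_zero]
        intro j hj
        exact ha m j (Or.inr hj))
      rw [h]
      refine Finset.sum_congr rfl fun j _ => ?_
      rw [C_mul_X_pow_eq_monomial]; rfl
    rw [this, Finset.sum_mul]
    refine Finset.sum_congr rfl fun j _ => ?_
    rw [smul_mul_assoc, uc_smul, mul_assoc, add_comm m m', uc_x_pow_mul, uc_y_pow_mul hb, mul_assoc]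
  · intro i hi
    rw [Finset.sum_mul, uc_sum]
    refine Finset.sum_eq_zero fun j _ => ?_
    rw [smul_mul_assoc, mul_assoc]
    apply uc_eq_zero (((hb.y_pow_mul j).x_pow_mul i).smul _)
    simp at hi; omega

theorem uc_pow {m n : ℕ} {a : Weyl R} (ha : Bd m n a) (k : ℕ) : uc (a ^ k) (k * m) = uc a m ^ k := by
  induction k with
  | zero => simp [uc]
  | succ k ih => rw [pow_succ, add_mul, one_mul, uc_mul (ha.pow k) ha, ih, pow_succ]

theorem exists_top {z : Weyl R} (hz : z ≠ 0) : ∃ m n, Bd m n z ∧ uc z m ≠ 0 := by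
  obtain ⟨D, hD⟩ := exists_bd z
  refine ⟨(sym R z).natDegree, D, ?_, ?_⟩
  · rintro i j (h | h)
    · rw [cf, coeff_eq_zero_of_natDegree_lt h]; simp
    · exact hD i j (by omega)
  · rw [uc, coeff_natDegree, Ne, leadingCoeff_eq_zero]
    intro h
    exact hz (sym_inj R (by rw [h, map_zero]))

instance [IsDomain R] : IsDomain (Weyl R) := by
  have : Nontrivial (Weyl R) := ⟨⟨0, 1, fun h => by
    have := congrArg (sym R) h
    simp at this⟩⟩
  have : NoZeroDivisors (Weyl R) := ⟨fun {a b} h => by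
    by_contra! hc
    obtain ⟨m, n, h1, h2⟩ := exists_top hc.1
    obtain ⟨m', n', h1', h2'⟩ := exists_top hc.2
    have := uc_mul h1 h1'
    rw [h] at this
    have h0 : uc (0 : Weyl R) (m + m') = 0 := by simp [uc]
    rw [h0] at this
    exact mul_ne_zero h2 h2' this.symm⟩
  exact NoZeroDivisors.to_isDomain _

end degs
end WW

end

noncomputable section
open Polynomial

namespace WW

section maps
variable {R S : Type} [CommRing R] [CommRing S]

/-- base change -/
def wmap (φ : R →+* S) : Weyl R →+* Weyl S :=
  letI : Algebra R (Weyl S) := ((algebraMap S (Weyl S)).comp φ).toAlgebra'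
    (fun c x => Algebra.commutes (φ c) x)
  (wlift (R := R) (Wx S) (Wy S) (wrel S)).toRingHom

@[simp] theorem wmap_x (φ : R →+* S) : wmap φ (Wx R) = Wx S :=
  letI : Algebra R (Weyl S) := ((algebraMap S (Weyl S)).comp φ).toAlgebra'
    (fun c x => Algebra.commutes (φ c) x)
  wlift_x (R := R) (Wx S) (Wy S) (wrel S)
@[simp] theorem wmap_y (φ : R →+* S) : wmap φ (Wy R) = Wy S :=
  letI : Algebra R (Weyl S) := ((algebraMap S (Weyl S)).comp φ).toAlgebra'
    (fun c x => Algebra.commutes (φ c) x)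
  wlift_y (R := R) (Wx S) (Wy S) (wrel S)
@[simp] theorem wmap_alg (φ : R →+* S) (r : R) :
    wmap φ (algebraMap R _ r) = algebraMap S _ (φ r) :=
  letI : Algebra R (Weyl S) := ((algebraMap S (Weyl S)).comp φ).toAlgebra'
    (fun c x => Algebra.commutes (φ c) x)
  (wlift (R := R) (Wx S) (Wy S) (wrel S)).commutes r
theorem wmap_smul (φ : R →+* S) (r : R) (z : Weyl R) : wmap φ (r • z) = φ r • wmap φ z := by
  rw [Algebra.smul_def, map_mul, wmap_alg, Algebra.smul_def]

theorem cf_wmap (φ : R →+* S) (z : Weyl R) : ∀ i j, cf S (wmap φ z) i j = φ (cf R z i j) := by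
  induction z using lin_ind with
  | h0 => simp [cf_zero]
  | ha a b h1 h2 => intro i j; rw [map_add, cf_add, h1, h2, cf_add, map_add]
  | hs r a h => intro i j; rw [wmap_smul, cf_smul, h, cf_smul, map_mul]
  | hm a b => intro i j; rw [map_mul, map_pow, map_pow, wmap_x, wmap_y, cf_mon, cf_mon]; split_ifs <;> simp

theorem wmap_inj {φ : R →+* S} (h : Function.Injective φ) : Function.Injective (wmap φ) := by
  intro a b hab
  apply cf_ext
  intro i j
  apply h
  rw [← cf_wmap, ← cf_wmap, hab]

/-- build an element from coefficients -/
def mk (D : ℕ) (c : ℕ → ℕ → R) : Weyl R :=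
  ∑ i ∈ Finset.range (D + 1), ∑ j ∈ Finset.range (D + 1), c i j • (Wx R ^ i * Wy R ^ j)

theorem cf_mk (D : ℕ) (c : ℕ → ℕ → R) (h : ∀ i j, D < i ∨ D < j → c i j = 0) (a b : ℕ) :
    cf R (mk D c) a b = c a b := by
  simp only [mk, cf_sum, cf_smul, cf_mon]
  by_cases hh : D < a ∨ D < b
  · rw [h a b hh]
    refine Finset.sum_eq_zero fun i hi => Finset.sum_eq_zero fun j hj => ?_
    rw [if_neg, mul_zero]
    rintro ⟨rfl, rfl⟩
    simp at hi hj
    omega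
  · rw [Finset.sum_eq_single_of_mem a (by simp; omega),
      Finset.sum_eq_single_of_mem b (by simp; omega)]
    · simp
    · intro j _ hj; simp [hj.symm]
    · intro i _ hi
      refine Finset.sum_eq_zero fun j hj => ?_
      simp [hi.symm]

/-- lift elements along a map hitting all coefficients -/
theorem exists_lift (φ : R →+* S) (D : ℕ) (z : Weyl S) (hD : Bd D D z)
    (h : ∀ i j, ∃ r, φ r = cf S z i j) : ∃ w : Weyl R, wmap φ w = z ∧ Bd D D w := by
  classical
  choose c hc using h
  let c' : ℕ → ℕ → R := fun i j => if D < i ∨ D < j then 0 else c i j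
  have h0 : ∀ i j, D < i ∨ D < j → c' i j = 0 := fun i j h => if_pos h
  refine ⟨mk D c', ?_, ?_⟩
  · apply cf_ext
    intro i j
    rw [cf_wmap, cf_mk D c' h0]
    by_cases hij : D < i ∨ D < j
    · rw [h0 i j hij, hD i j hij, map_zero]
    · rw [← hc]; simp only [c', if_neg hij]
  · intro i j hij
    rw [cf_mk D c' h0, h0 i j hij]

theorem neg_rel {T : Type} [Ring T] (x y : T) (h : y * x = x * y + 1) :
    x * -y = -y * x + 1 := by
  rw [mul_neg, neg_mul, h]; abel

variable (R) in
/-- anti-homomorphism to the opposite algebra -/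
def gamOp : Weyl R →ₐ[R] (Weyl R)ᵐᵒᵖ :=
  wlift (MulOpposite.op (Wx R)) (MulOpposite.op (-Wy R)) (by
    exact congrArg MulOpposite.op (neg_rel _ _ (wrel R)))

/-- the standard anti-involution -/
def gam (z : Weyl R) : Weyl R := (gamOp R z).unop

@[simp] theorem gam_x : gam (Wx R) = Wx R := by simp [gam, gamOp]
@[simp] theorem gam_y : gam (Wy R) = -Wy R := by simp [gam, gamOp]
theorem gam_add (a b : Weyl R) : gam (a + b) = gam a + gam b := by simp [gam]
theorem gam_sub (a b : Weyl R) : gam (a - b) = gam a - gam b := by simp [gam]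
theorem gam_neg (a : Weyl R) : gam (-a) = -gam a := by simp [gam]
theorem gam_zero : gam (0 : Weyl R) = 0 := by simp [gam]
theorem gam_smul (r : R) (a : Weyl R) : gam (r • a) = r • gam a := by simp [gam]
theorem gam_mul (a b : Weyl R) : gam (a * b) = gam b * gam a := by simp [gam]
theorem gam_one : gam (1 : Weyl R) = 1 := by simp [gam]
theorem gam_alg (r : R) : gam (algebraMap R (Weyl R) r) = algebraMap R _ r := by
  rw [Algebra.algebraMap_eq_smul_one, gam_smul, gam_one]
theorem gam_pow (a : Weyl R) (n : ℕ) : gam (a ^ n) = gam a ^ n := by simp [gam]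
theorem gam_gam (z : Weyl R) : gam (gam z) = z := by
  induction z using ind R with
  | hr r => rw [gam_alg, gam_alg]
  | hx => simp
  | hy => simp [gam_neg]
  | hm a b h1 h2 => rw [gam_mul, gam_mul, h1, h2]
  | ha a b h1 h2 => rw [gam_add, gam_add, h1, h2]
theorem gam_wmap (φ : R →+* S) (z : Weyl R) : gam (wmap φ z) = wmap φ (gam z) := by
  induction z using ind R with
  | hr r => rw [wmap_alg, gam_alg, gam_alg, wmap_alg]
  | hx => simp
  | hy => simp
  | hm a b h1 h2 => rw [gam_mul, map_mul, gam_mul, map_mul, h1, h2]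
  | ha a b h1 h2 => rw [gam_add, map_add, gam_add, map_add, h1, h2]

end maps
end WW

end

noncomputable section

namespace WW

section charp
variable {E : Type} [Ring E] {p : ℕ} [hp : Fact p.Prime]

theorem choose_cast (h0 : (p : E) = 0) (m : ℕ) (hm : m ≤ p - 1) :
    ((p - 1).choose m : E) = (-1) ^ m := by
  induction m with
  | zero => simp
  | succ m ih =>
    have hp1 : 1 < p := hp.out.one_lt
    have h1 : p.choose (m + 1) = (p - 1).choose m + (p - 1).choose (m + 1) := by
      conv_lhs => rw [show p = (p - 1) + 1 by omega]
      exact Nat.choose_succ_succ _ _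
    obtain ⟨c, hc⟩ := hp.out.dvd_choose_self (k := m + 1) (by omega) (by omega)
    have h2 : ((p.choose (m + 1) : ℕ) : E) = 0 := by rw [hc]; push_cast; rw [h0, zero_mul]
    rw [h1] at h2
    push_cast at h2
    rw [ih (by omega)] at h2
    rw [pow_succ, mul_neg, mul_one]
    exact (neg_eq_of_add_eq_zero_right h2).symm

theorem geom_char (h0 : (p : E) = 0) {l r : E} (h : Commute l r) :
    ∑ m ∈ Finset.range p, l ^ m * r ^ (p - 1 - m) = (l - r) ^ (p - 1) := by
  have hp1 : 1 < p := hp.out.one_lt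
  rw [sub_eq_add_neg, (h.neg_right).add_pow, show p - 1 + 1 = p by omega]
  refine Finset.sum_congr rfl fun m hm => ?_
  have hm' : m ≤ p - 1 := by simp at hm; omega
  rw [choose_cast h0 m hm', neg_pow r, mul_assoc, mul_assoc,
    (Commute.pow_left (Commute.neg_one_left (r ^ (p - 1 - m) * (-1) ^ m)) (p - 1 - m)).eq,
    mul_assoc, ← pow_add, show m + (p - 1 - m) = p - 1 by omega]
  have : ((-1 : E)) ^ (p - 1) = 1 := by
    have := choose_cast h0 (p - 1) le_rfl
    simpa using this.symm
  rw [this, mul_one]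

theorem sub_pow_p (h0 : (p : E) = 0) {l r : E} (h : Commute l r) :
    (l - r) ^ p = l ^ p - r ^ p := by
  have hp1 : 1 < p := hp.out.one_lt
  have := h.geom_sum₂_mul p
  rw [geom_char h0 h, ← pow_succ, show p - 1 + 1 = p by omega] at this
  exact this

theorem fact_char (h0 : (p : E) = 0) : ((p - 1).factorial : E) = -1 := by
  have h := ZMod.wilsons_lemma p
  have h1 : (p : ℤ) ∣ ((p - 1).factorial : ℤ) + 1 := by
    rw [← ZMod.intCast_zmod_eq_zero_iff_dvd]
    push_cast
    rw [h]; ring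
  obtain ⟨c, hc⟩ := h1
  have h2 : (((p - 1).factorial : ℤ) + 1 : ℤ) = ((p * c : ℤ) : ℤ) := hc
  have h3 := congrArg (Int.cast : ℤ → E) h2
  push_cast at h3
  rw [h0, zero_mul] at h3
  exact eq_neg_of_add_eq_zero_left h3

end charp

section comm
variable {B : Type} [Ring B]

theorem comm_pow_left (a w : B) (n : ℕ) :
    a ^ n * w - w * a ^ n =
      ∑ j ∈ Finset.range n, a ^ j * (a * w - w * a) * a ^ (n - 1 - j) := by
  induction n with
  | zero => simp
  | succ n ih =>
    rw [Finset.sum_range_succ]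
    have : ∀ j ∈ Finset.range n, a ^ j * (a * w - w * a) * a ^ (n + 1 - 1 - j) =
        (a ^ j * (a * w - w * a) * a ^ (n - 1 - j)) * a := by
      intro j hj
      simp at hj
      rw [mul_assoc _ _ a, ← pow_succ]; congr 2; omega
    rw [Finset.sum_congr rfl this, ← Finset.sum_mul, ← ih, show n + 1 - 1 - n = 0 by omega,
      pow_succ]
    noncomm_ring

theorem comm_pow_right (q w : B) (n : ℕ) :
    q * w ^ n - w ^ n * q =
      ∑ j ∈ Finset.range n, w ^ j * (q * w - w * q) * w ^ (n - 1 - j) := by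
  have h := comm_pow_left w q n
  rw [← neg_inj, neg_sub, h, ← Finset.sum_neg_distrib]
  refine Finset.sum_congr rfl fun j _ => ?_
  noncomm_ring

end comm

section ad
variable {A : Type} [Ring A]

/-- inner derivation -/
def ad (a : A) : Module.End (Subring.center A) A :=
  LinearMap.mulLeft (Subring.center A) a - LinearMap.mulRight (Subring.center A) a

theorem ad_apply (a x : A) : ad a x = a * x - x * a := by simp [ad]

variable {p : ℕ} [hp : Fact p.Prime]

theorem end_p (h0 : (p : A) = 0) : ((p : ℕ) : Module.End (Subring.center A) A) = 0 := by
  apply LinearMap.ext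
  intro x
  rw [Module.End.natCast_apply, nsmul_eq_mul, h0]; simp

theorem ad_pow_pred (h0 : (p : A) = 0) (a x : A) :
    (ad a ^ (p - 1)) x = ∑ j ∈ Finset.range p, a ^ j * x * a ^ (p - 1 - j) := by
  rw [ad, ← geom_char (end_p h0) (LinearMap.commute_mulLeft_right a a)]
  simp [LinearMap.sum_apply, mul_assoc]

theorem ad_pow_p (h0 : (p : A) = 0) (a : A) : ad a ^ p = ad (a ^ p) := by
  rw [ad, sub_pow_p (end_p h0) (LinearMap.commute_mulLeft_right a a), LinearMap.pow_mulLeft, LinearMap.pow_mulRight]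
  rfl

theorem ad_central {c : A} (h : c ∈ Subring.center A) : ad c = 0 := by
  apply LinearMap.ext
  intro x
  rw [ad_apply, (Subring.mem_center_iff.1 h x)]; simp

theorem ad_commute {P Q : A} (h : Q * P - P * Q = 1) : Commute (ad P) (ad Q) := by
  apply LinearMap.ext
  intro x
  simp only [Module.End.mul_apply, ad_apply]
  have h' : Q * P = P * Q + 1 := by rw [← h]; abel
  have e : P * (Q * x - x * Q) - (Q * x - x * Q) * P - (Q * (P * x - x * P) - (P * x - x * P) * Q)
    = x * (Q * P) - x * (P * Q) - ((Q * P) * x - P * Q * x) := by noncomm_ring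
  rw [← sub_eq_zero, e, h']; noncomm_ring

theorem ad_Q_pow {P Q : A} (h : Q * P - P * Q = 1) (n : ℕ) :
    ad Q (P ^ n) = n * P ^ (n - 1) := by
  rw [ad_apply, comm_pow_right, h]
  have : ∀ j ∈ Finset.range n, P ^ j * 1 * P ^ (n - 1 - j) = P ^ (n - 1) := by
    intro j hj
    simp at hj
    rw [mul_one, ← pow_add]; congr 1; omega
  rw [Finset.sum_congr rfl this]
  simp

theorem ad_Q_pow_iter {P Q : A} (h : Q * P - P * Q = 1) (n : ℕ) :
    (ad Q ^ n) (P ^ n) = n.factorial := by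
  induction n with
  | zero => simp
  | succ n ih =>
    rw [pow_succ, Module.End.mul_apply, ad_Q_pow h, Nat.add_sub_cancel, ← nsmul_eq_mul, map_nsmul,
      ih, Nat.factorial_succ, nsmul_eq_mul]
    push_cast; rfl

theorem lemX [NoZeroDivisors A] [CharP A p] {P Q : A} (h : Q * P - P * Q = 1) (n : ℕ) (hn : n ≤ p) :
    ∀ (c : ℕ → A), (∀ i, ad Q (c i) = 0) → ∑ i ∈ Finset.range n, c i * P ^ i = 0 →
      ∀ i < n, c i = 0 := by
  induction n with
  | zero => intro c _ _ i hi; omega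
  | succ n ih =>
    intro c hc hs
    have hd : ∀ i, ad Q (c i * P ^ i) = c i * (i * P ^ (i - 1)) := by
      intro i
      have e : ad Q (c i * P ^ i) = ad Q (c i) * P ^ i + c i * ad Q (P ^ i) := by
        simp only [ad_apply]; noncomm_ring
      rw [e, hc, zero_mul, zero_add, ad_Q_pow h]
    have h1 := congrArg (ad Q) hs
    rw [map_sum, map_zero, Finset.sum_congr rfl (fun i _ => hd i), Finset.sum_range_succ'] at h1
    simp only [Nat.cast_zero, zero_mul, mul_zero, add_zero, Nat.add_sub_cancel] at h1
    have h2 := ih (by omega) (fun i => c (i + 1) * ((i + 1 : ℕ) : A)) (by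
      intro i
      rw [← (Nat.cast_commute (i + 1) (c (i + 1))).eq, ← nsmul_eq_mul, map_nsmul, hc, smul_zero])
      (by simpa only [mul_assoc] using h1)
    have h3 : ∀ i < n, c (i + 1) = 0 := by
      intro i hi
      have := h2 i hi
      rcases mul_eq_zero.1 this with h | h
      · exact h
      · rw [CharP.cast_eq_zero_iff A p] at h
        have := Nat.le_of_dvd (by omega) h
        omega
    have h4 : c 0 = 0 := by
      rw [Finset.sum_range_succ', Finset.sum_eq_zero (fun i hi => by
        rw [h3 i (by simpa using hi), zero_mul])] at hs
      simpa using hs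
    rintro (_ | i) hi
    · exact h4
    · exact h3 i (by omega)

/-- the family is linearly independent over the centre -/
theorem lin_indep [NoZeroDivisors A] [CharP A p] {P Q : A} (h : Q * P - P * Q = 1)
    (z : ℕ → ℕ → Subring.center A)
    (hz : ∑ i ∈ Finset.range p, ∑ j ∈ Finset.range p, z i j • (Q ^ j * P ^ i) = 0) :
    ∀ i < p, ∀ j < p, z i j = 0 := by
  intro i hi j hj
  have hcomm : ∀ (a : A) (w : Subring.center A) (n : ℕ), ad a ((w : A) * a ^ n) = 0 := by
    intro a w n
    have := Subring.mem_center_iff.1 w.2 a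
    rw [ad_apply, ← mul_assoc, this, mul_assoc, mul_assoc, pow_mul_comm', sub_self]
  have h1 := lemX h p le_rfl (fun i => ∑ j ∈ Finset.range p, (z i j : A) * Q ^ j)
    (fun i => by rw [map_sum]; exact Finset.sum_eq_zero fun j _ => hcomm Q _ j)
    (by
      rw [← hz]
      refine Finset.sum_congr rfl fun i _ => ?_
      rw [Finset.sum_mul]
      refine Finset.sum_congr rfl fun j _ => ?_
      rw [mul_assoc]; rfl) i hi
  have h' : (-P) * Q - Q * (-P) = 1 := by rw [← h]; noncomm_ring
  have h2 := lemX h' p le_rfl (fun j => (z i j : A)) (fun j => by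
    have := hcomm (-P) (z i j) 0
    simpa using this) h1 j hj
  exact Subtype.ext h2

theorem near [IsDomain A] [CharP A p] {P Q : A} (h : Q * P - P * Q = 1) (w : Finset A)
    (hw : Submodule.span (Subring.center A) (w : Set A) = ⊤) (hc : w.card ≤ p * p) (a : A) :
    ∃ z : Subring.center A, z ≠ 0 ∧
      (z : A) * a ∈ Algebra.adjoin (Subring.center A) ({P, Q} : Set A) := by
  classical
  let v : Option (Fin p × Fin p) → A := fun o => o.elim a (fun q => Q ^ (q.2 : ℕ) * P ^ (q.1 : ℕ))
  have hn : ¬ LinearIndependent (Subring.center A) v := by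
    intro hl
    have := linearIndependent_le_span_finset v hl w hw
    simp at this
    have h2 : p * p + 1 ≤ w.card := by exact_mod_cast this
    omega
  obtain ⟨g, hg, o, ho⟩ := Fintype.not_linearIndependent_iff.1 hn
  rw [Fintype.sum_option] at hg
  simp only [v, Option.elim] at hg
  have hmem : ∑ x : Fin p × Fin p, g (some x) • (Q ^ (x.2 : ℕ) * P ^ (x.1 : ℕ)) ∈
      Algebra.adjoin (Subring.center A) ({P, Q} : Set A) := by
    refine Subalgebra.sum_mem _ fun x _ => Subalgebra.smul_mem _ (mul_mem (pow_mem ?_ _) (pow_mem ?_ _)) _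
    · exact Algebra.subset_adjoin (by simp)
    · exact Algebra.subset_adjoin (by simp)
  refine ⟨g none, ?_, ?_⟩
  · intro h0
    rw [h0, zero_smul, zero_add] at hg
    have h3 := lin_indep h (fun i j => if hij : i < p ∧ j < p then g (some (⟨i, hij.1⟩, ⟨j, hij.2⟩)) else 0) (by
      rw [Fintype.sum_prod_type] at hg
      rw [← hg, Finset.sum_range]
      refine Finset.sum_congr rfl fun i _ => ?_
      rw [Finset.sum_range]
      refine Finset.sum_congr rfl fun j _ => ?_
      rw [dif_pos ⟨i.2, j.2⟩])
    rcases o with _ | ⟨i, j⟩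
    · exact ho h0
    · have := h3 i i.2 j j.2
      rw [dif_pos ⟨i.2, j.2⟩] at this
      exact ho this
  · have : (g none : A) * a = - ∑ x : Fin p × Fin p, g (some x) • (Q ^ (x.2 : ℕ) * P ^ (x.1 : ℕ)) :=
      eq_neg_of_add_eq_zero_left hg
    rw [this]
    exact neg_mem hmem

theorem commute_adjoin {P Q b : A} (h1 : Commute b P) (h2 : Commute b Q) {a : A}
    (ha : a ∈ Algebra.adjoin (Subring.center A) ({P, Q} : Set A)) : Commute b a := by
  induction ha using Algebra.adjoin_induction with
  | mem x hx => rcases hx with rfl | rfl <;> assumption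
  | algebraMap r => exact (Algebra.commutes r b).symm
  | add x y _ _ h1 h2 => exact h1.add_right h2
  | mul x y _ _ h1 h2 => exact h1.mul_right h2

theorem central_of [IsDomain A] [CharP A p] {P Q : A} (h : Q * P - P * Q = 1) (w : Finset A)
    (hw : Submodule.span (Subring.center A) (w : Set A) = ⊤) (hc : w.card ≤ p * p) {b : A}
    (h1 : Commute b P) (h2 : Commute b Q) : b ∈ Subring.center A := by
  rw [Subring.mem_center_iff]
  intro a
  obtain ⟨z, hz, hm⟩ := near h w hw hc a
  have := (commute_adjoin h1 h2 hm).eq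
  have hzb := Subring.mem_center_iff.1 z.2 b
  have h3 : (z : A) * (b * a - a * b) = 0 := by
    rw [mul_sub, ← mul_assoc, ← hzb, ← mul_assoc, ← this, mul_assoc]; simp
  rcases mul_eq_zero.1 h3 with h | h
  · exact absurd (Subtype.ext h) hz
  · exact (sub_eq_zero.1 h).symm

theorem pow_central [IsDomain A] [CharP A p] {P Q : A} (h : Q * P - P * Q = 1) (w : Finset A)
    (hw : Submodule.span (Subring.center A) (w : Set A) = ⊤) (hc : w.card ≤ p * p) :
    P ^ p ∈ Subring.center A ∧ Q ^ p ∈ Subring.center A := by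
  have h' : (-P) * Q - Q * (-P) = 1 := by rw [← h]; noncomm_ring
  constructor
  · refine central_of h w hw hc (Commute.pow_left rfl _) ?_
    have := ad_Q_pow h p
    rw [CharP.cast_eq_zero, zero_mul, ad_apply] at this
    exact (sub_eq_zero.1 this).symm
  · refine central_of h w hw hc ?_ (Commute.pow_left rfl _)
    have := ad_Q_pow h' p
    rw [CharP.cast_eq_zero, zero_mul, ad_apply] at this
    have := sub_eq_zero.1 this
    rw [neg_mul, mul_neg, neg_inj] at this
    exact this.symm

theorem L_vanish [IsDomain A] [CharP A p] {P Q : A} (h : Q * P - P * Q = 1) (w : Finset A)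
    (hw : Submodule.span (Subring.center A) (w : Set A) = ⊤) (hc : w.card ≤ p * p) (b a : A) :
    (ad Q ^ (p - 1)) ((ad P ^ (p - 1)) (b * a - a * b)) = 0 := by
  have h0 : (p : A) = 0 := CharP.cast_eq_zero A p
  have hp1 : 1 < p := hp.out.one_lt
  obtain ⟨hP, hQ⟩ := pow_central h w hw hc
  have e : p = p - 1 + 1 := by omega
  have hPp : ad P ^ p = 0 := by rw [ad_pow_p h0, ad_central hP]
  have hQp : ad Q ^ p = 0 := by rw [ad_pow_p h0, ad_central hQ]
  have hLP : ∀ a, (ad Q ^ (p - 1)) ((ad P ^ (p - 1)) (P * a - a * P)) = 0 := by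
    intro a
    rw [← ad_apply, ← Module.End.mul_apply (ad P ^ (p - 1)), ← pow_succ, ← e, hPp]; simp
  have hLQ : ∀ a, (ad Q ^ (p - 1)) ((ad P ^ (p - 1)) (Q * a - a * Q)) = 0 := by
    intro a
    rw [← ad_apply, ← Module.End.mul_apply (ad P ^ (p - 1)), ((ad_commute h).pow_left _).eq,
      Module.End.mul_apply, ← Module.End.mul_apply (ad Q ^ (p - 1)), ← pow_succ, ← e, hQp]; simp
  have key : ∀ b ∈ Algebra.adjoin (Subring.center A) ({P, Q} : Set A), ∀ a,
      (ad Q ^ (p - 1)) ((ad P ^ (p - 1)) (b * a - a * b)) = 0 := by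
    intro b hb
    induction hb using Algebra.adjoin_induction with
    | mem x hx => rcases hx with rfl | rfl <;> assumption
    | algebraMap r => intro a; rw [Algebra.commutes]; simp
    | add x y _ _ h1 h2 =>
      intro a
      rw [show (x + y) * a - a * (x + y) = (x * a - a * x) + (y * a - a * y) by noncomm_ring,
        map_add, map_add, h1, h2, add_zero]
    | mul x y _ _ h1 h2 =>
      intro a
      rw [show x * y * a - a * (x * y) = (x * (y * a) - (y * a) * x) + (y * (a * x) - (a * x) * y) by
        noncomm_ring, map_add, map_add, h1, h2, add_zero]
  obtain ⟨z, hz, hm⟩ := near h w hw hc b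
  have h1 := key _ hm a
  have h2 : (z : A) * b * a - a * ((z : A) * b) = z • (b * a - a * b) := by
    change _ = (z : A) * (b * a - a * b)
    rw [← mul_assoc a, (Subring.mem_center_iff.1 z.2 a), mul_sub]; noncomm_ring
  rw [h2, map_smul, map_smul] at h1
  have h3 : (z : A) * _ = 0 := h1
  rcases mul_eq_zero.1 h3 with h | h
  · exact absurd (Subtype.ext h) hz
  · exact h

end ad

end WW

end

noncomputable section

namespace WW

section poisson
variable {A B : Type} [Ring A] [Ring B] (π : B →+* A) {p : ℕ}

/-- Poisson bracket relation -/
def Br (p : ℕ) (x y : B) (t : A) : Prop := ∃ T : B, x * y - y * x = (p : B) * T ∧ π T = t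

variable {π}

theorem Br.uniq (hc : ∀ a b : B, (p : B) * a = (p : B) * b → a = b) {x y : B} {s t : A}
    (h1 : Br π p x y s) (h2 : Br π p x y t) : s = t := by
  obtain ⟨S, hS, rfl⟩ := h1
  obtain ⟨T, hT, rfl⟩ := h2
  rw [hc S T (hS ▸ hT)]

theorem Br.symm {x y : B} {t : A} (h : Br π p x y t) : Br π p y x (-t) := by
  obtain ⟨T, hT, rfl⟩ := h
  exact ⟨-T, by rw [mul_neg, ← hT, neg_sub], by simp⟩

theorem Br.self (x : B) : Br π p x x 0 := ⟨0, by simp, by simp⟩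

theorem Br.add {x y z : B} {s t : A} (h1 : Br π p x z s) (h2 : Br π p y z t) :
    Br π p (x + y) z (s + t) := by
  obtain ⟨S, hS, rfl⟩ := h1
  obtain ⟨T, hT, rfl⟩ := h2
  exact ⟨S + T, by rw [mul_add (p : B), ← hS, ← hT]; noncomm_ring, by simp⟩

theorem Br.mul {x y z : B} {s t : A} (h1 : Br π p x z s) (h2 : Br π p y z t) :
    Br π p (x * y) z (π x * t + s * π y) := by
  obtain ⟨S, hS, rfl⟩ := h1
  obtain ⟨T, hT, rfl⟩ := h2
  refine ⟨x * T + S * y, ?_, by simp⟩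
  have e : x * y * z - z * (x * y) = x * (y * z - z * y) + (x * z - z * x) * y := by noncomm_ring
  rw [e, hS, hT, mul_add, ← mul_assoc x, ← (Nat.cast_commute p x).eq]; simp only [mul_assoc]

theorem Br.zero_left (z : B) : Br π p 0 z 0 := ⟨0, by simp, by simp⟩

theorem Br.sum {ι : Type} (s : Finset ι) (x : ι → B) (z : B) (t : ι → A)
    (h : ∀ i ∈ s, Br π p (x i) z (t i)) : Br π p (∑ i ∈ s, x i) z (∑ i ∈ s, t i) := by
  classical
  induction s using Finset.induction_on with
  | empty => simpa using Br.zero_left z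
  | insert a s ha ih =>
    rw [Finset.sum_insert ha, Finset.sum_insert ha]
    exact (h a (by simp)).add (ih fun i hi => h i (by simp [hi]))

theorem Br.sum_right {ι : Type} (s : Finset ι) (x : ι → B) (z : B) (t : ι → A)
    (h : ∀ i ∈ s, Br π p z (x i) (t i)) : Br π p z (∑ i ∈ s, x i) (∑ i ∈ s, t i) := by
  have := (Br.sum s x z (fun i => - t i) fun i hi => (h i hi).symm).symm
  simpa using this

theorem Br.central_left {c z : B} (h : c ∈ Subring.center B) : Br π p c z 0 :=
  ⟨0, by rw [Subring.mem_center_iff.1 h z]; simp, by simp⟩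

theorem Br.pow {x y : B} {ξ t : Subring.center A} (hx : π x = ξ) (h : Br π p x y (t : A)) (n : ℕ) :
    ∃ s : Subring.center A, Br π p (x ^ n) y (s : A) ∧ s * ξ = n * (ξ ^ n * t) := by
  induction n with
  | zero => exact ⟨0, by simpa using Br.central_left (Subring.one_mem _), by simp⟩
  | succ n ih =>
    obtain ⟨s, hs, hs'⟩ := ih
    refine ⟨ξ * s + t * ξ ^ n, ?_, ?_⟩
    · rw [pow_succ']
      have := h.mul hs
      simpa [hx] using this
    · push_cast
      linear_combination ξ * hs'

/-- bracket of monomials -/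
theorem Br.mon {U V : B} {u v : Subring.center A} (hU : π U = u) (hV : π V = v)
    (h : Br π p V U (-1)) (i j k l : ℕ) :
    ∃ s : Subring.center A, Br π p (U ^ i * V ^ j) (U ^ k * V ^ l) (s : A) ∧
      s * (u * v) = (i * l - j * k : ℤ) * (u ^ (i + k) * v ^ (j + l)) := by
  have h1 : Br π p V U ((-1 : Subring.center A) : A) := by simpa using h
  have key : ∀ a b : ℕ, ∃ s : Subring.center A, Br π p (V ^ a) (U ^ b) (s : A) ∧
      s * (u * v) = - (a * b : ℤ) * (u ^ b * v ^ a) := by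
    intro a b
    obtain ⟨s, hs, hs'⟩ := Br.pow hV h1 a
    have h2 : Br π p U (V ^ a) ((-s : Subring.center A) : A) := by simpa using hs.symm
    obtain ⟨t, ht, ht'⟩ := Br.pow hU h2 b
    refine ⟨-t, by simpa using ht.symm, ?_⟩
    push_cast
    linear_combination (-v) * ht' + (b : Subring.center A) * u ^ b * hs'
  obtain ⟨s, hs, hs'⟩ := key j k
  obtain ⟨t, ht, ht'⟩ := key l i
  have hUi : ∀ n, π (U ^ n) = ((u ^ n : Subring.center A) : A) := by intro n; simp [hU]
  have hVi : ∀ n, π (V ^ n) = ((v ^ n : Subring.center A) : A) := by intro n; simp [hV]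
  have b1 : Br π p (U ^ i) (U ^ k) ((0 : Subring.center A) : A) :=
    ⟨0, by rw [(Commute.refl U).pow_pow i k]; simp, by simp⟩
  have b2 : Br π p (V ^ l) (V ^ j) ((0 : Subring.center A) : A) :=
    ⟨0, by rw [(Commute.refl V).pow_pow l j]; simp, by simp⟩
  -- bracket of U^i V^j with U^k
  have c1 := (b1.mul hs).symm
  have c2 := (ht.symm.mul b2.symm).symm
  have c3 := c1.mul c2
  have c4 := c3.symm
  refine ⟨u ^ i * s * v ^ l - t * v ^ j * u ^ k, ?_, ?_⟩
  · convert c4 using 1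
    simp only [hUi, hVi]
    norm_cast
    simp only [mul_zero, zero_mul, add_zero, zero_add]
    ring
  · push_cast at hs' ht' ⊢
    linear_combination u ^ i * v ^ l * hs' - v ^ j * u ^ k * ht'

theorem Br.p_left {x y : B} (hy : π y ∈ Subring.center A) : Br π p ((p : B) * x) y 0 := by
  refine ⟨x * y - y * x, ?_, ?_⟩
  · rw [mul_sub, mul_assoc, ← mul_assoc y, ← (Nat.cast_commute p y).eq, mul_assoc]
  · rw [map_sub, map_mul, map_mul, Subring.mem_center_iff.1 hy]; simp

theorem Br.change {x x' y y' : B} {t : A} (hker : ∀ b, π b = 0 → ∃ c, b = (p : B) * c)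
    (hx : π x = π x') (hy : π y = π y') (hxc : π x ∈ Subring.center A)
    (hyc : π y ∈ Subring.center A) (h : Br π p x y t) : Br π p x' y' t := by
  obtain ⟨c, hc⟩ := hker (x' - x) (by simp [hx])
  obtain ⟨d, hd⟩ := hker (y' - y) (by simp [hy])
  have h1 : Br π p x' y (t + 0) := by
    rw [show x' = x + (p : B) * c by rw [← hc]; abel]
    exact h.add (Br.p_left hyc)
  rw [add_zero] at h1
  have h2 : Br π p y' x' (-t + 0) := by
    rw [show y' = y + (p : B) * d by rw [← hd]; abel]
    exact h1.symm.add (Br.p_left (hx ▸ hxc))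
  simpa using h2.symm

theorem br_pow [Fact p.Prime] (h0 : (p : A) = 0) {P Q H : B}
    (h : Q * P - P * Q = 1 + (p : B) * H)
    (hL : (ad (π Q) ^ (p - 1)) ((ad (π P) ^ (p - 1)) (π H)) = 0) :
    Br π p (Q ^ p) (P ^ p) (-1) := by
  have hp1 : 1 < p := (Fact.out : p.Prime).one_lt
  have hPQ : π Q * π P - π P * π Q = 1 := by
    rw [← map_mul, ← map_mul, ← map_sub, h]; simp [h0]
  let T1 : B := P ^ (p - 1) + ∑ j ∈ Finset.range p, P ^ j * H * P ^ (p - 1 - j)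
  have e1 : Q * P ^ p - P ^ p * Q = (p : B) * T1 := by
    rw [comm_pow_right, h]
    have : ∀ j ∈ Finset.range p, P ^ j * (1 + (p : B) * H) * P ^ (p - 1 - j) =
        P ^ (p - 1) + (p : B) * (P ^ j * H * P ^ (p - 1 - j)) := by
      intro j hj
      simp at hj
      rw [mul_add, add_mul, mul_one, ← pow_add, show j + (p - 1 - j) = p - 1 by omega,
        ← mul_assoc, ← (Nat.cast_commute p (P ^ j)).eq]
      simp only [mul_assoc]
    rw [Finset.sum_congr rfl this, Finset.sum_add_distrib, ← Finset.mul_sum]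
    simp [T1, mul_add]
  refine ⟨∑ j ∈ Finset.range p, Q ^ j * T1 * Q ^ (p - 1 - j), ?_, ?_⟩
  · rw [comm_pow_left, e1, Finset.mul_sum]
    refine Finset.sum_congr rfl fun j _ => ?_
    rw [← mul_assoc (Q ^ j), ← (Nat.cast_commute p (Q ^ j)).eq]
    simp only [mul_assoc]
  · have hT1 : π T1 = π P ^ (p - 1) + (ad (π P) ^ (p - 1)) (π H) := by
      rw [ad_pow_pred h0]
      simp [T1]
    have : π (∑ j ∈ Finset.range p, Q ^ j * T1 * Q ^ (p - 1 - j)) = (ad (π Q) ^ (p - 1)) (π T1) := by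
      rw [ad_pow_pred h0]
      simp
    rw [this, hT1, map_add, hL, add_zero, ad_Q_pow_iter hPQ, fact_char h0]

end poisson

end WW

end

noncomputable section

namespace WW

section combi

variable {k : Type} [Field k] {p : ℕ} [CharP k p]

theorem single (D : ℕ) (hD : D * D < p) (f g : ℕ → ℕ → k)
    (hf : ∀ i j, f i j ≠ 0 → i ≤ D ∧ j ≤ D) (hg : ∀ i j, g i j ≠ 0 → i ≤ D ∧ j ≤ D)
    (hid : ∀ M N : ℕ, ∑ a ∈ Finset.range (D + 1), ∑ b ∈ Finset.range (D + 1),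
      ∑ c ∈ Finset.range (D + 1), ∑ d ∈ Finset.range (D + 1), (if a + c = M ∧ b + d = N then
        g a b * f c d * (((b : ℤ) * c - a * d : ℤ) : k) else 0) = if M = 1 ∧ N = 1 then 1 else 0)
    (a b c d : ℕ) (h1 : g a b ≠ 0) (h2 : f c d ≠ 0) (hne : b * c ≠ a * d)
    (hu : ∀ a' b' c' d', g a' b' ≠ 0 → f c' d' ≠ 0 → a' + c' = a + c → b' + d' = b + d →
      a' = a ∧ b' = b) : a + c = 1 ∧ b + d = 1 := by
  by_contra hcon
  have h := hid (a + c) (b + d)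
  obtain ⟨e1, e2⟩ := hg _ _ h1
  obtain ⟨e3, e4⟩ := hf _ _ h2
  have hz : ∀ a' b' c' d', ¬ (a' = a ∧ b' = b ∧ c' = c ∧ d' = d) →
      (if a' + c' = a + c ∧ b' + d' = b + d then
        g a' b' * f c' d' * (((b' : ℤ) * c' - a' * d' : ℤ) : k) else 0) = 0 := by
    intro a' b' c' d' hn
    split_ifs with hs
    · by_cases hz : g a' b' * f c' d' = 0
      · rw [hz, zero_mul]
      · have := hu a' b' c' d' (left_ne_zero_of_mul hz) (right_ne_zero_of_mul hz) hs.1 hs.2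
        exact absurd (by omega) hn
    · rfl
  rw [if_neg hcon, Finset.sum_eq_single_of_mem a (by simp; omega),
    Finset.sum_eq_single_of_mem b (by simp; omega), Finset.sum_eq_single_of_mem c (by simp; omega),
    Finset.sum_eq_single_of_mem d (by simp; omega), if_pos ⟨rfl, rfl⟩] at h
  · have h3 : (((b : ℤ) * c - a * d : ℤ) : k) = 0 := by
      rcases mul_eq_zero.1 h with h | h
      · exact absurd h (mul_ne_zero h1 h2)
      · exact h
    rw [CharP.intCast_eq_zero_iff k p] at h3
    have b1 : b * c ≤ D * D := Nat.mul_le_mul e2 e3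
    have b2 : a * d ≤ D * D := Nat.mul_le_mul e1 e4
    have := Int.eq_zero_of_abs_lt_dvd h3 (by
      rw [abs_lt]
      constructor
      · have : ((a * d : ℕ) : ℤ) < p := by exact_mod_cast lt_of_le_of_lt b2 hD
        push_cast at this
        have : (0 : ℤ) ≤ (b : ℤ) * c := by positivity
        linarith
      · have : ((b * c : ℕ) : ℤ) < p := by exact_mod_cast lt_of_le_of_lt b1 hD
        push_cast at this
        have : (0 : ℤ) ≤ (a : ℤ) * d := by positivity
        linarith)
    apply hne
    zify
    linarith
  · intro d' _ hn; exact hz _ _ _ _ (by tauto)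
  · intro c' _ hn; exact Finset.sum_eq_zero fun _ _ => hz _ _ _ _ (by tauto)
  · intro b' _ hn
    exact Finset.sum_eq_zero fun _ _ => Finset.sum_eq_zero fun _ _ => hz _ _ _ _ (by tauto)
  · intro a' _ hn
    exact Finset.sum_eq_zero fun _ _ => Finset.sum_eq_zero fun _ _ =>
      Finset.sum_eq_zero fun _ _ => hz _ _ _ _ (by tauto)

theorem exists_greatest (S : ℕ → Prop) (D : ℕ) (h : ∀ n, S n → n ≤ D) (h' : ∃ n, S n) :
    ∃ n, S n ∧ ∀ m, S m → m ≤ n := by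
  classical
  obtain ⟨n, hn⟩ := h'
  exact ⟨Nat.findGreatest S D, Nat.findGreatest_spec (h n hn) hn,
    fun m hm => Nat.le_findGreatest (h m hm) hm⟩

theorem combi (D : ℕ) (hD : D * D < p) (f g : ℕ → ℕ → k)
    (hf : ∀ i j, f i j ≠ 0 → i ≤ D ∧ j ≤ D) (hg : ∀ i j, g i j ≠ 0 → i ≤ D ∧ j ≤ D)
    (hg0 : ∀ i, g i 0 = 0)
    (hid : ∀ M N : ℕ, ∑ a ∈ Finset.range (D + 1), ∑ b ∈ Finset.range (D + 1),
      ∑ c ∈ Finset.range (D + 1), ∑ d ∈ Finset.range (D + 1), (if a + c = M ∧ b + d = N then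
        g a b * f c d * (((b : ℤ) * c - a * d : ℤ) : k) else 0) = if M = 1 ∧ N = 1 then 1 else 0) :
    (∀ i j, f i j ≠ 0 → i ≤ 1) ∧ (∀ i j, g i j ≠ 0 → i = 0) := by
  classical
  have hS := single D hD f g hf hg hid
  have hg0' : ∀ i j, g i j ≠ 0 → 1 ≤ j := by
    rintro i (_ | j) h
    · exact absurd (hg0 i) h
    · omega
  -- step 0
  have hex : ∃ i c, g i 1 ≠ 0 ∧ f c 0 ≠ 0 ∧ 1 ≤ c := by
    by_contra! hcon
    have h := hid 1 1
    rw [if_pos ⟨rfl, rfl⟩, Finset.sum_eq_zero] at h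
    · exact zero_ne_one h
    · intro i _
      refine Finset.sum_eq_zero fun j _ => Finset.sum_eq_zero fun c _ =>
        Finset.sum_eq_zero fun l _ => ?_
      split_ifs with hm
      swap
      · rfl
      by_cases hj : j = 0
      · rw [hj, hg0]; simp
      · obtain rfl : j = 1 := by omega
        obtain rfl : l = 0 := by omega
        by_cases h1 : g i 1 = 0
        · simp [h1]
        · by_cases h2 : f c 0 = 0
          · simp [h2]
          · have := hcon i c h1 h2
            obtain rfl : c = 0 := by omega
            simp
  obtain ⟨i0, c0, hi0, hc0, hc1⟩ := hex
  obtain ⟨I, hI, hImax⟩ := exists_greatest (fun i => g i 1 ≠ 0) D (fun i h => (hg _ _ h).1) ⟨i0, hi0⟩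
  obtain ⟨c, hc, hcmax⟩ := exists_greatest (fun i => f i 0 ≠ 0) D (fun i h => (hf _ _ h).1) ⟨c0, hc0⟩
  have hcc := hcmax c0 hc0
  have h0 := hS I 1 c 0 hI hc (by simp; omega) (by
    intro a' b' c' d' ha hcc h1 h2
    have := hg0' _ _ ha
    obtain rfl : b' = 1 := by omega
    obtain rfl : d' = 0 := by omega
    have := hImax a' ha
    have := hcmax c' hcc
    omega)
  obtain rfl : c = 1 := by omega
  obtain rfl : I = 0 := by omega
  -- step 1
  by_contra hcon
  let F : Finset (ℕ × ℕ) :=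
    (Finset.range (D + 1) ×ˢ Finset.range (D + 1)).filter (fun q => f q.1 q.2 ≠ 0)
  let G : Finset (ℕ × ℕ) :=
    (Finset.range (D + 1) ×ˢ Finset.range (D + 1)).filter (fun q => g q.1 q.2 ≠ 0)
  have mF : ∀ i j, (i, j) ∈ F ↔ f i j ≠ 0 := by
    intro i j
    simp only [F, Finset.mem_filter, Finset.mem_product, Finset.mem_range]
    constructor
    · exact fun h => h.2
    · intro h; have := hf _ _ h; exact ⟨by omega, h⟩
  have mG : ∀ i j, (i, j) ∈ G ↔ g i j ≠ 0 := by
    intro i j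
    simp only [G, Finset.mem_filter, Finset.mem_product, Finset.mem_range]
    constructor
    · exact fun h => h.2
    · intro h; have := hg _ _ h; exact ⟨by omega, h⟩
  let S : Finset (ℕ × ℕ) := (F.filter (fun q => 2 ≤ q.1)).image (fun q => (q.1 - 1, q.2)) ∪
    (G.filter (fun q => 1 ≤ q.1)).image (fun q => (q.1, q.2 - 1))
  have SF : ∀ i j, f i j ≠ 0 → 2 ≤ i → (i - 1, j) ∈ S := by
    intro i j h hi
    refine Finset.mem_union_left _ (Finset.mem_image.2 ⟨(i, j), ?_, rfl⟩)
    exact Finset.mem_filter.2 ⟨(mF i j).2 h, hi⟩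
  have SG : ∀ i j, g i j ≠ 0 → 1 ≤ i → (i, j - 1) ∈ S := by
    intro i j h hi
    refine Finset.mem_union_right _ (Finset.mem_image.2 ⟨(i, j), ?_, rfl⟩)
    exact Finset.mem_filter.2 ⟨(mG i j).2 h, hi⟩
  have f1 : ∀ i j, f i j ≠ 0 → 2 ≤ i → 1 ≤ j := by
    rintro i (_ | j) h hi
    · have := hcmax i h; omega
    · omega
  have g1 : ∀ i j, g i j ≠ 0 → 1 ≤ i → 2 ≤ j := by
    intro i j h hi
    have := hg0' i j h
    by_contra hj
    obtain rfl : j = 1 := by omega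
    have := hImax i h
    omega
  have mS : ∀ a b, (a, b) ∈ S → (f (a + 1) b ≠ 0 ∧ 1 ≤ a ∧ 1 ≤ b) ∨
      (g a (b + 1) ≠ 0 ∧ 1 ≤ a ∧ 1 ≤ b) := by
    intro a b h
    rcases Finset.mem_union.1 h with h | h
    · obtain ⟨⟨i, j⟩, h1, h2⟩ := Finset.mem_image.1 h
      obtain ⟨h3, h4⟩ := Finset.mem_filter.1 h1
      rw [mF] at h3
      simp only [Prod.mk.injEq] at h2 h4
      obtain ⟨rfl, rfl⟩ := h2
      left
      have := f1 _ _ h3 h4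
      rw [show i - 1 + 1 = i by omega]
      exact ⟨h3, by omega, by omega⟩
    · obtain ⟨⟨i, j⟩, h1, h2⟩ := Finset.mem_image.1 h
      obtain ⟨h3, h4⟩ := Finset.mem_filter.1 h1
      rw [mG] at h3
      simp only [Prod.mk.injEq] at h2 h4
      obtain ⟨rfl, rfl⟩ := h2
      right
      have := g1 _ _ h3 h4
      rw [show j - 1 + 1 = j by omega]
      exact ⟨h3, by omega, by omega⟩
  have hSne : S.Nonempty := by
    rw [not_and_or] at hcon
    push Not at hcon
    rcases hcon with ⟨i, j, h1, h2⟩ | ⟨i, j, h1, h2⟩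
    · exact ⟨_, SF i j h1 (by omega)⟩
    · exact ⟨_, SG i j h1 (by omega)⟩
  obtain ⟨⟨a, b⟩, habS, hmax⟩ := Finset.exists_max_image S (fun q => (q.1 : ℚ) / q.2) hSne
  have hab := mS a b habS
  have ha1 : 1 ≤ a := by tauto
  have hb1 : 1 ≤ b := by tauto
  have hmax' : ∀ a' b', (a', b') ∈ S → a' * b ≤ a * b' := by
    intro a' b' h
    have h1 := hmax _ h
    simp only at h1
    have hb' : 1 ≤ b' := by have := mS a' b' h; tauto
    rw [div_le_div_iff₀ (by exact_mod_cast hb') (by exact_mod_cast hb1)] at h1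
    exact_mod_cast h1
  have wF : ∀ i j, f i j ≠ 0 → b * i ≤ b + a * j := by
    intro i j h
    by_cases hi : 2 ≤ i
    · have := hmax' _ _ (SF i j h hi)
      obtain ⟨i, rfl⟩ : ∃ t, i = t + 1 := ⟨i - 1, by omega⟩
      simp at this
      nlinarith
    · have : i ≤ 1 := by omega
      nlinarith [Nat.mul_le_mul_left b this, Nat.zero_le (a * j)]
  have wG : ∀ i j, g i j ≠ 0 → b * i + a ≤ a * j := by
    intro i j h
    have hj := hg0' _ _ h
    obtain ⟨j, rfl⟩ : ∃ t, j = t + 1 := ⟨j - 1, by omega⟩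
    by_cases hi : 1 ≤ i
    · have := hmax' _ _ (SG i _ h hi)
      simp at this
      nlinarith
    · obtain rfl : i = 0 := by omega
      nlinarith [Nat.zero_le (a * j)]
  obtain ⟨⟨c, d⟩, hcd, hcdmax⟩ := Finset.exists_max_image
    (F.filter (fun q => b * q.1 = b + a * q.2)) (fun q => q.2)
    ⟨(1, 0), Finset.mem_filter.2 ⟨(mF _ _).2 hc, by simp⟩⟩
  obtain ⟨⟨i, j⟩, hij, hijmax⟩ := Finset.exists_max_image
    (G.filter (fun q => b * q.1 + a = a * q.2)) (fun q => q.2)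
    ⟨(0, 1), Finset.mem_filter.2 ⟨(mG _ _).2 hI, by simp⟩⟩
  obtain ⟨hcd1, hcd2⟩ := Finset.mem_filter.1 hcd
  obtain ⟨hij1, hij2⟩ := Finset.mem_filter.1 hij
  rw [mF] at hcd1
  rw [mG] at hij1
  simp only at hcd2 hij2
  have hj := hg0' _ _ hij1
  have hfin := hS i j c d hij1 hcd1 (by
    intro he
    have e1 : b * (j * c) = j * b + j * (a * d) := by
      rw [mul_left_comm, hcd2]; ring
    have e2 : b * (i * d) + a * d = d * (a * j) := by
      rw [← hij2]; ring
    rw [he] at e1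
    have : 0 < j * b := by positivity
    nlinarith) (by
    intro a' b' c' d' h1 h2 h3 h4
    have w1 := wG _ _ h1
    have w2 := wF _ _ h2
    have s1 : b * a' + b * c' = b * i + b * c := by rw [← mul_add, h3, mul_add]
    have s2 : a * b' + a * d' = a * j + a * d := by rw [← mul_add, h4, mul_add]
    have q1 : b * a' + a = a * b' := by omega
    have q2 : b * c' = b + a * d' := by omega
    have r1 := hijmax (a', b') (Finset.mem_filter.2 ⟨(mG _ _).2 h1, q1⟩)
    have r2 := hcdmax (c', d') (Finset.mem_filter.2 ⟨(mF _ _).2 h2, q2⟩)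
    simp only at r1 r2
    obtain rfl : b' = j := by omega
    refine ⟨?_, rfl⟩
    have : b * a' = b * i := by omega
    exact Nat.eq_of_mul_eq_mul_left hb1 this)
  rcases hab with ⟨h, _, _⟩ | ⟨h, _, _⟩
  · have := hcdmax (a + 1, b) (Finset.mem_filter.2 ⟨(mF _ _).2 h, by ring⟩)
    simp only at this
    omega
  · have := hijmax (a, b + 1) (Finset.mem_filter.2 ⟨(mG _ _).2 h, by ring⟩)
    simp only at this
    omega

end combi
end WW

end

noncomputable section
open Polynomial

namespace WW

section cent
variable {R : Type} [CommRing R]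

theorem mem_center {z : Weyl R} (hx : Commute z (Wx R)) (hy : Commute z (Wy R)) :
    z ∈ Subring.center (Weyl R) := by
  rw [Subring.mem_center_iff]
  intro g
  suffices h : Commute z g from h.eq.symm
  induction g using ind R with
  | hr r => exact (Algebra.commutes r z).symm
  | hx => exact hx
  | hy => exact hy
  | hm a b h1 h2 => exact h1.mul_right h2
  | ha a b h1 h2 => exact h1.add_right h2

theorem alg_center (r : R) : algebraMap R (Weyl R) r ∈ Subring.center (Weyl R) :=
  mem_center (Algebra.commutes r _) (Algebra.commutes r _)

variable {k : Type} [Field k] {p : ℕ} [hp : Fact p.Prime] [CharP k p]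

theorem cast_p : ((p : ℕ) : Weyl k) = 0 := by
  have h : ((p : ℕ) : k) = 0 := CharP.cast_eq_zero k p
  rw [← map_natCast (algebraMap k (Weyl k)), h, map_zero]

theorem charP_weyl : CharP (Weyl k) p :=
  charP_of_injective_algebraMap (algebraMap k (Weyl k)).injective p

theorem xp_center : Wx k ^ p ∈ Subring.center (Weyl k) := by
  refine mem_center (Commute.pow_left rfl _) ?_
  have := y_mul_x_pow k p
  rw [cast_p, zero_mul, add_zero] at this
  exact this.symm

theorem yp_center : Wy k ^ p ∈ Subring.center (Weyl k) := by
  refine mem_center ?_ (Commute.pow_left rfl _)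
  have := y_pow_mul_x (R := k) p
  rw [CharP.cast_eq_zero, zero_smul, add_zero] at this
  exact this

variable (k p) in
/-- spanning set over the centre -/
def spanSet : Finset (Weyl k) := by
  classical
  exact (Finset.range p ×ˢ Finset.range p).image (fun q => Wx k ^ q.1 * Wy k ^ q.2)

theorem span_spanSet : Submodule.span (Subring.center (Weyl k)) (spanSet k p : Set (Weyl k)) = ⊤ := by
  have hp0 : 0 < p := hp.out.pos
  rw [eq_top_iff]
  rintro z -
  induction z using lin_ind with
  | h0 => exact zero_mem _
  | ha a b h1 h2 => exact add_mem h1 h2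
  | hs r a h =>
    have := Submodule.smul_mem _ (⟨_, alg_center r⟩ : Subring.center (Weyl k)) h
    rwa [Algebra.smul_def]
  | hm i j =>
    have h1 : Wx k ^ (i % p) * Wy k ^ (j % p) ∈ Submodule.span (Subring.center (Weyl k)) (spanSet k p : Set (Weyl k)) := by
      apply Submodule.subset_span
      simp only [spanSet, Finset.coe_image, Set.mem_image, Finset.mem_coe, Finset.mem_product,
        Finset.mem_range]
      exact ⟨(i % p, j % p), ⟨Nat.mod_lt _ hp0, Nat.mod_lt _ hp0⟩, rfl⟩
    have c1 := Subring.pow_mem _ (xp_center (k := k) (p := p)) (i / p)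
    have c2 := Subring.pow_mem _ (yp_center (k := k) (p := p)) (j / p)
    have := Submodule.smul_mem _ (⟨_, Subring.mul_mem _ c1 c2⟩ : Subring.center (Weyl k)) h1
    have e : Wx k ^ i * Wy k ^ j = ((Wx k ^ p) ^ (i / p) * (Wy k ^ p) ^ (j / p)) *
        (Wx k ^ (i % p) * Wy k ^ (j % p)) := by
      have c2' := Subring.mem_center_iff.1 c2 (Wx k ^ (i % p))
      rw [mul_assoc, ← mul_assoc _ (Wx k ^ (i % p)), ← c2', mul_assoc, ← mul_assoc, ← pow_mul,
        ← pow_mul, ← pow_add, ← pow_add, Nat.div_add_mod, Nat.div_add_mod]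
    rw [e]
    exact this

theorem card_spanSet : (spanSet k p).card ≤ p * p := by
  classical
  refine Finset.card_image_le.trans ?_
  simp

theorem cf_central {z : Weyl k} (hz : z ∈ Subring.center (Weyl k)) {i j : ℕ} (h : cf k z i j ≠ 0) :
    p ∣ i ∧ p ∣ j := by
  rw [Subring.mem_center_iff] at hz
  constructor
  · rcases i with _ | i
    · simp
    · have := cf_comm_y z i j
      rw [hz, sub_self, cf_zero] at this
      rw [← CharP.cast_eq_zero_iff k p]
      push_cast
      exact (mul_eq_zero.1 this.symm).resolve_right h
  · rcases j with _ | j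
    · simp
    · have := cf_comm_x z i j
      rw [hz, sub_self, cf_zero] at this
      rw [← CharP.cast_eq_zero_iff k p]
      push_cast
      exact (mul_eq_zero.1 this.symm).resolve_right h

theorem central_expand {z : Weyl k} (hz : z ∈ Subring.center (Weyl k)) {D : ℕ}
    (hD : Bd (p * D) (p * D) z) :
    z = ∑ i ∈ Finset.range (D + 1), ∑ j ∈ Finset.range (D + 1),
      cf k z (p * i) (p * j) • ((Wx k ^ p) ^ i * (Wy k ^ p) ^ j) := by
  have hp0 : 0 < p := hp.out.pos
  apply cf_ext
  intro a b
  simp only [cf_sum, cf_smul, ← pow_mul, cf_mon]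
  by_cases h : cf k z a b = 0
  · rw [h, eq_comm]
    refine Finset.sum_eq_zero fun i hi => Finset.sum_eq_zero fun j hj => ?_
    split_ifs with hh
    · rw [← hh.1, ← hh.2, h, zero_mul]
    · simp
  · obtain ⟨⟨i, rfl⟩, ⟨j, rfl⟩⟩ := cf_central hz h
    have hb : ¬ (p * D < p * i ∨ p * D < p * j) := fun hh => h (hD _ _ hh)
    rw [Nat.mul_lt_mul_left hp0, Nat.mul_lt_mul_left hp0] at hb
    rw [Finset.sum_eq_single_of_mem i (by simp; omega),
      Finset.sum_eq_single_of_mem j (by simp; omega)]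
    · simp
    · intro j' _ hn
      rw [if_neg, mul_zero]
      rintro ⟨-, h⟩
      exact hn (Nat.eq_of_mul_eq_mul_left hp0 h.symm)
    · intro i' _ hn
      refine Finset.sum_eq_zero fun j' _ => ?_
      rw [if_neg, mul_zero]
      rintro ⟨h, -⟩
      exact hn (Nat.eq_of_mul_eq_mul_left hp0 h.symm)

theorem odd_cf (hp2 : p ≠ 2) {z : Weyl k} (hz : z ∈ Subring.center (Weyl k)) {D : ℕ}
    (hD : Bd (p * D) (p * D) z) (hg : gam z = -z) (i : ℕ) : cf k z (p * i) 0 = 0 := by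
  have hp0 : 0 < p := hp.out.pos
  have key : ∀ (s : Finset ℕ) (c : ℕ → ℕ → k), cf k (gam (∑ i ∈ s, ∑ j ∈ s,
      c i j • ((Wx k ^ p) ^ i * (Wy k ^ p) ^ j))) (p * i) 0 =
      cf k (∑ i ∈ s, ∑ j ∈ s, c i j • ((Wx k ^ p) ^ i * (Wy k ^ p) ^ j)) (p * i) 0 := by
    intro s c
    have hs : ∀ (t : Finset ℕ) (F : ℕ → Weyl k), gam (∑ i ∈ t, F i) = ∑ i ∈ t, gam (F i) := by
      intro t F
      simp [gam]
    simp only [hs, cf_sum, gam_smul, cf_smul]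
    refine Finset.sum_congr rfl fun a _ => Finset.sum_congr rfl fun b _ => ?_
    congr 1
    have c2 := Subring.mem_center_iff.1 (Subring.pow_mem _ (yp_center (k := k) (p := p)) b)
      ((Wx k ^ p) ^ a)
    have : gam ((Wx k ^ p) ^ a * (Wy k ^ p) ^ b) =
        ((-1 : k) ^ p) ^ b • ((Wx k ^ p) ^ a * (Wy k ^ p) ^ b) := by
      rw [gam_mul, gam_pow, gam_pow, gam_pow, gam_pow, gam_x, gam_y, c2, ← neg_one_smul k, _root_.smul_pow,
        _root_.smul_pow, smul_mul_assoc]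
    rw [this, cf_smul]
    rcases b with _ | b
    · simp
    · simp only [← pow_mul]
      rw [cf_mon, if_neg, mul_zero]
      have : p * (b + 1) ≠ 0 := by positivity
      omega
  have h1 := key (Finset.range (D + 1)) (fun a b => cf k z (p * a) (p * b))
  rw [← central_expand hz hD, hg, cf_neg] at h1
  have h2 : (2 : k) * cf k z (p * i) 0 = 0 := by linear_combination -h1
  refine (mul_eq_zero.1 h2).resolve_left ?_
  intro h
  have h3 : ((2 : ℕ) : k) = 0 := by exact_mod_cast h
  rw [CharP.cast_eq_zero_iff k p] at h3
  have := Nat.le_of_dvd (by norm_num) h3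
  have := hp.out.two_le
  omega

theorem solve_comm {H : Weyl k} {D : ℕ} (hH : Bd D D H) (hD : D + 1 < p) :
    ∃ S, Wy k * S - S * Wy k = H := by
  refine ⟨mk (D + 1) (fun i j => cf k H (i - 1) j / i), ?_⟩
  apply cf_ext
  intro i j
  rw [cf_comm_y]
  rw [cf_mk]
  · by_cases hi : i ≤ D
    · rw [Nat.add_sub_cancel]
      have : ((i + 1 : ℕ) : k) ≠ 0 := by
        intro h
        rw [CharP.cast_eq_zero_iff k p] at h
        have := Nat.le_of_dvd (by omega) h
        omega
      push_cast at this ⊢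
      field_simp
    · rw [Nat.add_sub_cancel, hH i j (by omega)]; simp
  · intro i j hij
    rcases i with _ | i
    · simp
    · rw [hH _ _ (by omega), zero_div]

theorem top_argument {P : Weyl k} (hc : P ^ p ∈ Subring.center (Weyl k)) (e : ℕ)
    (h : ∀ i j, cf k (P ^ p) (p * i) (p * j) ≠ 0 → i ≤ e) (i j : ℕ) (hij : cf k P i j ≠ 0) :
    i ≤ e := by
  have hP : P ≠ 0 := by rintro rfl; exact hij (cf_zero _ _)
  obtain ⟨m, n, hb, ht⟩ := exists_top hP
  have hm : i ≤ m := by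
    by_contra hh
    exact hij (hb i j (by omega))
  have h1 := uc_pow hb p
  have h2 : uc (P ^ p) (p * m) ≠ 0 := by rw [h1]; exact pow_ne_zero _ ht
  obtain ⟨b, hb'⟩ : ∃ b, (uc (P ^ p) (p * m)).coeff b ≠ 0 := by
    by_contra! hcon
    exact h2 (Polynomial.ext (by simpa using hcon))
  have h3 : cf k (P ^ p) (p * m) b ≠ 0 := hb'
  obtain ⟨-, ⟨j', rfl⟩⟩ := cf_central hc h3
  exact hm.trans (h m j' h3)

end cent
end WW

end

noncomputable section

namespace WW

theorem neg_help {T : Type} [Ring T] (z w : T) (h : -1 = z) : w = -(z * w) := by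
  rw [← h]; simp

theorem odd_help {T : Type} [Ring T] {n : ℕ} (h : Odd n) (z : T) : (-z) ^ n = - z ^ n :=
  h.neg_pow z

section charp
variable {O k : Type} [CommRing O] [IsDomain O] [Field k] {p : ℕ}

theorem Br.smul_left {φ : O →+* k} {x y : Weyl O} {t : Weyl k} (r : O)
    (h : Br (wmap φ) p x y t) : Br (wmap φ) p (r • x) y (φ r • t) := by
  obtain ⟨T, hT, rfl⟩ := h
  refine ⟨r • T, ?_, by rw [wmap_smul]⟩
  rw [smul_mul_assoc, mul_smul_comm, mul_smul_comm, ← hT, smul_sub]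

theorem Br.smul_right {φ : O →+* k} {x y : Weyl O} {t : Weyl k} (r : O)
    (h : Br (wmap φ) p x y t) : Br (wmap φ) p x (r • y) (φ r • t) := by
  have := (h.symm.smul_left r).symm
  simpa using this

theorem cast_mul_eq (z : Weyl O) : (p : Weyl O) * z = (p : O) • z := by
  rw [Algebra.smul_def, map_natCast]

theorem p_cancel (hp0 : (p : O) ≠ 0) (a b : Weyl O) (h : (p : Weyl O) * a = (p : Weyl O) * b) :
    a = b := by
  rw [cast_mul_eq, cast_mul_eq] at h
  apply cf_ext
  intro i j
  have := congrArg (fun z => cf O z i j) h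
  simp only [cf_smul] at this
  exact mul_left_cancel₀ hp0 this

theorem ker_wmap {φ : O →+* k} (hk : ∀ x, φ x = 0 → ∃ y, x = (p : O) * y) (b : Weyl O)
    (hb : wmap φ b = 0) : ∃ c, b = (p : Weyl O) * c := by
  obtain ⟨D, hD⟩ := exists_bd b
  have : ∀ i j, ∃ y, cf O b i j = (p : O) * y := by
    intro i j
    apply hk
    rw [← cf_wmap, hb, cf_zero]
  classical
  choose c hc using this
  refine ⟨mk D (fun i j => if D < i ∨ D < j then 0 else c i j), ?_⟩
  rw [cast_mul_eq]
  apply cf_ext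
  intro i j
  rw [cf_smul, cf_mk]
  · split_ifs with h
    · rw [hD _ _ (by omega), mul_zero]
    · exact hc i j
  · intro i j h
    rw [if_pos h]

variable [hp : Fact p.Prime] [CharP k p]

theorem bracket_powers (hp2 : p ≠ 2) (φ : O →+* k) (hs : Function.Surjective φ)
    (hk : ∀ x, φ x = 0 → ∃ y, x = (p : O) * y) (hp0 : (p : O) ≠ 0)
    {P Q : Weyl k} (h : Q * P - P * Q = 1) {D : ℕ} (hP : Bd D D P) (hQ : Bd D D Q)
    (hD : 2 * D + 1 < p) :
    ∃ P' Q' : Weyl O, wmap φ P' = P ∧ wmap φ Q' = Q ∧ Br (wmap φ) p (Q' ^ p) (P' ^ p) (-1) := by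
  haveI : CharP (Weyl k) p := charP_weyl
  obtain ⟨P', hP', bP⟩ := exists_lift φ D P hP (fun i j => hs _)
  obtain ⟨Q', hQ', bQ⟩ := exists_lift φ D Q hQ (fun i j => hs _)
  refine ⟨P', Q', hP', hQ', ?_⟩
  obtain ⟨H, hH⟩ := ker_wmap hk (Q' * P' - P' * Q' - 1) (by simp [hP', hQ', h])
  have bH : Bd (2 * D) (2 * D) H := by
    have b1 : Bd (2 * D) (2 * D) (Q' * P' - P' * Q' - 1) := by
      rw [two_mul]
      exact ((bQ.mul bP).sub (bP.mul bQ)).sub Bd.one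
    intro i j hij
    have := b1 i j hij
    rw [hH, cast_mul_eq, cf_smul] at this
    exact (mul_eq_zero.1 this).resolve_left hp0
  have bH' : Bd (2 * D) (2 * D) (wmap φ H) := by
    intro i j hij
    rw [cf_wmap, bH i j hij, map_zero]
  obtain ⟨S, hS⟩ := solve_comm bH' hD
  refine br_pow (H := H) cast_p (by rw [← hH]; abel) ?_
  rw [hP', hQ', ← hS]
  exact L_vanish h (spanSet k p) span_spanSet card_spanSet _ _

theorem charp_main (hp2 : p ≠ 2) (φ : O →+* k) (hs : Function.Surjective φ)
    (hk : ∀ x, φ x = 0 → ∃ y, x = (p : O) * y) (hp0 : (p : O) ≠ 0)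
    {P Q : Weyl k} (h : Q * P - P * Q = 1) (hg : gam Q = -Q) {D : ℕ} (hP : Bd D D P)
    (hQ : Bd D D Q) (hD : 2 * D + 1 < p) (hDD : D * D < p) :
    (∀ i j, cf k P i j ≠ 0 → i ≤ 1) ∧ (∀ i j, cf k Q i j ≠ 0 → i ≤ 0) := by
  haveI : CharP (Weyl k) p := charP_weyl
  have hpp : 0 < p := hp.out.pos
  obtain ⟨cP, cQ⟩ := pow_central h (spanSet k p) span_spanSet card_spanSet
  obtain ⟨P', Q', hP', hQ', hbr⟩ := bracket_powers hp2 φ hs hk hp0 h hP hQ hD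
  have hxy : Br (wmap φ) p (Wy O ^ p) (Wx O ^ p) (-1) := by
    refine br_pow (H := 0) cast_p (by rw [wrel O]; simp) (by simp)
  set f : ℕ → ℕ → k := fun i j => cf k (P ^ p) (p * i) (p * j) with hf
  set g : ℕ → ℕ → k := fun i j => cf k (Q ^ p) (p * i) (p * j) with hgd
  choose σ hσ using hs
  let mono (c : ℕ → ℕ → k) : Weyl O := ∑ i ∈ Finset.range (D + 1), ∑ j ∈ Finset.range (D + 1),
      σ (c i j) • ((Wx O ^ p) ^ i * (Wy O ^ p) ^ j)
  have hmono : ∀ c, wmap φ (mono c) = ∑ i ∈ Finset.range (D + 1), ∑ j ∈ Finset.range (D + 1),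
      c i j • ((Wx k ^ p) ^ i * (Wy k ^ p) ^ j) := by
    intro c
    simp only [mono, map_sum, wmap_smul, hσ, map_mul, map_pow, wmap_x, wmap_y]
  have eF : wmap φ (mono f) = P ^ p := by
    rw [hmono]; exact (central_expand cP (hP.pow p)).symm
  have eG : wmap φ (mono g) = Q ^ p := by
    rw [hmono]; exact (central_expand cQ (hQ.pow p)).symm
  have hbr2 : Br (wmap φ) p (mono g) (mono f) (-1) := by
    refine hbr.change (ker_wmap hk) ?_ ?_ ?_ ?_
    · rw [eG, map_pow, hQ']
    · rw [eF, map_pow, hP']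
    · rw [map_pow, hQ']; exact cQ
    · rw [map_pow, hP']; exact cP
  let u : Subring.center (Weyl k) := ⟨Wx k ^ p, xp_center⟩
  let v : Subring.center (Weyl k) := ⟨Wy k ^ p, yp_center⟩
  have hu : wmap φ (Wx O ^ p) = u := by simp [u]
  have hv : wmap φ (Wy O ^ p) = v := by simp [v]
  choose s hs1 hs2 using fun a b c d => Br.mon hu hv hxy a b c d
  have hbr3 : Br (wmap φ) p (mono g) (mono f)
      (∑ a ∈ Finset.range (D + 1), ∑ b ∈ Finset.range (D + 1),
        ∑ c ∈ Finset.range (D + 1), ∑ d ∈ Finset.range (D + 1),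
          φ (σ (f c d)) • φ (σ (g a b)) • (s a b c d : Weyl k)) := by
    refine Br.sum _ _ _ _ fun a _ => Br.sum _ _ _ _ fun b _ => ?_
    refine Br.sum_right _ _ _ _ fun c _ => Br.sum_right _ _ _ _ fun d _ => ?_
    exact ((hs1 a b c d).smul_left _).smul_right _
  have E := hbr2.uniq (p_cancel hp0) hbr3
  have E2 : Wx k ^ p * Wy k ^ p = ∑ a ∈ Finset.range (D + 1), ∑ b ∈ Finset.range (D + 1),
        ∑ c ∈ Finset.range (D + 1), ∑ d ∈ Finset.range (D + 1),
          (g a b * f c d * (((b : ℤ) * c - a * d : ℤ) : k)) •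
            (Wx k ^ (p * (a + c)) * Wy k ^ (p * (b + d))) := by
    have h1 : ∀ z w : Weyl k, -1 = z → w = -(z * w) := by
      intro z w hz
      exact neg_help z w hz
    rw [h1 _ (Wx k ^ p * Wy k ^ p) E]
    simp only [Finset.sum_mul, ← Finset.sum_neg_distrib, hσ]
    refine Finset.sum_congr rfl fun a _ => Finset.sum_congr rfl fun b _ =>
      Finset.sum_congr rfl fun c _ => Finset.sum_congr rfl fun d _ => ?_
    have h2 := congrArg (Subtype.val) (hs2 a b c d)
    have h3 : (s a b c d : Weyl k) * (Wx k ^ p * Wy k ^ p) = (((a * d - b * c : ℤ)) : Weyl k) *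
      ((Wx k ^ p) ^ (a + c) * (Wy k ^ p) ^ (b + d)) := h2
    rw [smul_mul_assoc, smul_mul_assoc, h3, ← pow_mul, ← pow_mul, smul_smul,
      ← map_intCast (algebraMap k (Weyl k)), ← Algebra.smul_def, smul_smul, ← neg_smul]
    congr 1
    push_cast
    ring
  have hb : ∀ {Z : Weyl k} (_ : Bd D D Z) (i j : ℕ), cf k (Z ^ p) (p * i) (p * j) ≠ 0 →
      i ≤ D ∧ j ≤ D := by
    intro Z hZ i j hne
    by_contra hcon
    apply hne
    refine hZ.pow p _ _ ?_
    rw [Nat.mul_lt_mul_left hpp, Nat.mul_lt_mul_left hpp]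
    omega
  have hodd : Odd p := hp.out.odd_of_ne_two hp2
  obtain ⟨r1, r2⟩ := combi (p := p) D hDD f g (hb hP) (hb hQ)
    (fun i => by
      have := odd_cf hp2 cQ (hQ.pow p) (by rw [gam_pow, hg]; exact odd_help hodd Q) i
      simpa [hgd] using this)
    (by
      intro M N
      have := congrArg (fun z => cf k z (p * M) (p * N)) E2
      simp only [cf_sum, cf_smul, cf_mon] at this
      have e1 : (p * M = p ∧ p * N = p) ↔ (M = 1 ∧ N = 1) := by
        constructor
        · rintro ⟨h1, h2⟩
          exact ⟨Nat.eq_of_mul_eq_mul_left hpp (by simpa using h1),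
            Nat.eq_of_mul_eq_mul_left hpp (by simpa using h2)⟩
        · rintro ⟨rfl, rfl⟩; simp
      simp only [e1] at this
      rw [this]
      refine Finset.sum_congr rfl fun a _ => Finset.sum_congr rfl fun b _ =>
        Finset.sum_congr rfl fun c _ => Finset.sum_congr rfl fun d _ => ?_
      have e2 : (p * M = p * (a + c) ∧ p * N = p * (b + d)) ↔ (a + c = M ∧ b + d = N) := by
        rw [Nat.mul_right_inj hpp.ne', Nat.mul_right_inj hpp.ne', eq_comm, eq_comm (a := N)]
      simp only [e2, mul_ite, mul_one, mul_zero])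
  exact ⟨top_argument cP 1 r1, top_argument cQ 0 fun i j hij => (r2 i j hij).le⟩

end charp
end WW

end

noncomputable section

namespace WW

theorem jac_int : IsJacobsonRing ℤ := by
  rw [isJacobsonRing_iff_prime_eq]
  intro I hI
  by_cases h : I = ⊥
  · subst h
    rw [eq_bot_iff]
    intro x hx
    rw [Ideal.mem_jacobson_iff] at hx
    obtain ⟨z, hz⟩ := hx x
    rw [Ideal.mem_bot] at hz ⊢
    have h1 : (1 + x * x) * z = 1 := by linear_combination hz
    have h2 : 0 < 1 + x * x := by nlinarith
    have h3 := Int.eq_one_of_mul_eq_one_right h2.le h1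
    nlinarith
  · haveI := hI.isMaximal h
    exact Ideal.jacobson_eq_self_of_isMaximal

theorem finite_residue (R κ : Type) [CommRing R] [Algebra ℤ R] [Algebra.FiniteType ℤ R] [Field κ]
    (ψ : R →+* κ) (hψ : Function.Surjective ψ) :
    ∃ p : ℕ, p.Prime ∧ CharP κ p ∧ Finite κ := by
  let ψ' : R →ₐ[ℤ] κ := { ψ with commutes' := fun n => by simp }
  haveI : Algebra.FiniteType ℤ κ := Algebra.FiniteType.of_surjective ψ' hψ
  haveI := jac_int
  haveI : Module.Finite ℤ κ := finite_of_finite_type_of_isJacobsonRing ℤ κ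
  obtain ⟨p, hp⟩ := CharP.exists κ
  rcases CharP.char_is_prime_or_zero κ p with h | h
  · refine ⟨p, h, hp, ?_⟩
    haveI : Fact p.Prime := ⟨h⟩
    letI : Algebra (ZMod p) κ := ZMod.algebra κ p
    haveI : Module.Finite (ZMod p) κ := Module.Finite.of_restrictScalars_finite ℤ (ZMod p) κ
    exact Module.finite_of_finite (ZMod p)
  · subst h
    haveI := CharP.charP_to_charZero κ
    exact absurd (isField_of_isIntegral_of_isField (R := ℤ) (S := κ)
      (RingHom.injective_int _) (Field.toIsField κ)) Int.not_isField

theorem charzero_aux {K : Type} [Field K] [CharZero K] {P Q : Weyl K} (h : Q * P - P * Q = 1)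
    (hg : gam Q = -Q) (c : K) (hc : c ≠ 0) :
    ∃ (R κ : Type) (_ : CommRing R) (_ : Field κ) (ι : R →+* K) (ψ : R →+* κ)
      (P' Q' : Weyl R), Function.Injective ι ∧ wmap ι P' = P ∧ wmap ι Q' = Q ∧
      (∀ r, ι r = c → ψ r ≠ 0) ∧ (∀ i j, cf κ (wmap ψ P') i j ≠ 0 → i ≤ 1) ∧
      (∀ i j, cf κ (wmap ψ Q') i j ≠ 0 → i ≤ 0) := by
  classical
  obtain ⟨D1, hD1⟩ := exists_bd P
  obtain ⟨D2, hD2⟩ := exists_bd Q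
  set D := D1 + D2 with hD
  have bP : Bd D D P := fun i j hij => hD1 i j (by omega)
  have bQ : Bd D D Q := fun i j hij => hD2 i j (by omega)
  set N := D * D + 2 * D + 3 with hN
  set rg := Finset.range (D + 1) ×ˢ Finset.range (D + 1)
  let s : Finset K := rg.image (fun q => cf K P q.1 q.2) ∪ rg.image (fun q => cf K Q q.1 q.2) ∪
    {c⁻¹, ((N.factorial : ℕ) : K)⁻¹}
  let R := Algebra.adjoin ℤ (s : Set K)
  haveI : Algebra.FiniteType ℤ R := (Subalgebra.fg_iff_finiteType _).1 (Subalgebra.fg_adjoin_finset s)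
  have hsub : ∀ x ∈ s, x ∈ R := fun x hx => Algebra.subset_adjoin hx
  obtain ⟨m, hm⟩ := Ideal.exists_maximal R
  letI : Field (R ⧸ m) := Ideal.Quotient.field m
  obtain ⟨p, hp, hchar, hfin⟩ := finite_residue R (R ⧸ m) (Ideal.Quotient.mk m)
    Ideal.Quotient.mk_surjective
  haveI : Fact p.Prime := ⟨hp⟩
  let ι : R →+* K := R.val.toRingHom
  have hι : Function.Injective ι := Subtype.val_injective
  let ψ : R →+* R ⧸ m := Ideal.Quotient.mk m
  have hlift : ∀ Z : Weyl K, Bd D D Z → (∀ i j, i ≤ D → j ≤ D → cf K Z i j ∈ s) →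
      ∃ w : Weyl R, wmap ι w = Z ∧ Bd D D w := by
    intro Z hZ hh
    refine exists_lift ι D Z hZ ?_
    intro i j
    by_cases hij : D < i ∨ D < j
    · exact ⟨0, by rw [hZ i j hij, map_zero]⟩
    · exact ⟨⟨_, hsub _ (hh i j (by omega) (by omega))⟩, rfl⟩
  obtain ⟨P', hP', bP'⟩ := hlift P bP (fun i j hi hj => by
    refine Finset.mem_union_left _ (Finset.mem_union_left _ ?_)
    exact Finset.mem_image.2 ⟨(i, j), by simp [rg]; omega, rfl⟩)
  obtain ⟨Q', hQ', bQ'⟩ := hlift Q bQ (fun i j hi hj => by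
    refine Finset.mem_union_left _ (Finset.mem_union_right _ ?_)
    exact Finset.mem_image.2 ⟨(i, j), by simp [rg]; omega, rfl⟩)
  have hunit : ∀ (r : R), ι r ≠ 0 → (ι r)⁻¹ ∈ s → ψ r ≠ 0 := by
    intro r hr hs h0
    have h1 : r * ⟨_, hsub _ hs⟩ = 1 := hι (by
      rw [map_mul, map_one]; exact mul_inv_cancel₀ hr)
    have := congrArg ψ h1
    rw [map_mul, h0, zero_mul, map_one] at this
    exact zero_ne_one this
  have hpN : N < p := by
    by_contra hcon
    have hN0 : ((N.factorial : ℕ) : K) ≠ 0 := Nat.cast_ne_zero.2 (Nat.factorial_ne_zero N)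
    refine hunit ((N.factorial : ℕ) : R) (by rw [map_natCast]; exact hN0)
      (by rw [map_natCast]; simp [s]) ?_
    rw [map_natCast, CharP.cast_eq_zero_iff (R ⧸ m) p]
    exact hp.dvd_factorial.2 (by omega)
  refine ⟨R, R ⧸ m, inferInstance, inferInstance, ι, ψ, P', Q', hι, hP', hQ', ?_, ?_⟩
  · intro r hr
    exact hunit r (by rw [hr]; exact hc) (by rw [hr]; simp [s])
  · have h' : Q' * P' - P' * Q' = 1 := wmap_inj hι (by simp [hP', hQ', h])
    have hg' : gam Q' = -Q' := wmap_inj hι (by rw [← gam_wmap, hQ', hg, map_neg, hQ'])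
    have hbd : ∀ Z : Weyl R, Bd D D Z → Bd D D (wmap ψ Z) := by
      intro Z hZ i j hij
      rw [cf_wmap, hZ i j hij, map_zero]
    refine charp_main (O := WittVector p (R ⧸ m)) (p := p) (D := D) (by omega)
      WittVector.constantCoeff (WittVector.constantCoeff_surjective p) ?_
      (WittVector.p_nonzero p _) ?_ ?_ (hbd _ bP') (hbd _ bQ') (by omega) (by omega)
    · intro x hx
      have h1 : x ∈ RingHom.ker (WittVector.constantCoeff (p := p) (R := R ⧸ m)) := hx
      rw [WittVector.ker_constantCoeff, Ideal.mem_span_singleton] at h1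
      exact h1
    · rw [← map_mul, ← map_mul, ← map_sub, h', map_one]
    · rw [gam_wmap, hg', map_neg]

theorem charzero_main {K : Type} [Field K] [CharZero K] {P Q : Weyl K} (h : Q * P - P * Q = 1)
    (hg : gam Q = -Q) :
    (∀ i j, cf K P i j ≠ 0 → i ≤ 1) ∧ (∀ i j, cf K Q i j ≠ 0 → i ≤ 0) := by
  constructor
  · intro i j hij
    obtain ⟨R, κ, _, _, ι, ψ, P', Q', hι, hP, hQ, hr, h1, h2⟩ := charzero_aux h hg _ hij
    refine h1 i j ?_
    rw [cf_wmap]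
    exact hr _ (by rw [← cf_wmap, hP])
  · intro i j hij
    obtain ⟨R, κ, _, _, ι, ψ, P', Q', hι, hP, hQ, hr, h1, h2⟩ := charzero_aux h hg _ hij
    refine h2 i j ?_
    rw [cf_wmap]
    exact hr _ (by rw [← cf_wmap, hQ])

end WW

end

noncomputable section
open Polynomial

namespace WW

section fin
variable {K : Type} [Field K] [CharZero K]

/-- `P` and `Q` generate the whole algebra. -/
def Gen (P Q : Weyl K) : Prop := ∀ S : Subalgebra K (Weyl K), P ∈ S → Q ∈ S → S = ⊤

theorem top_of_xy (S : Subalgebra K (Weyl K)) (hx : Wx K ∈ S) (hy : Wy K ∈ S) : S = ⊤ := by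
  rw [eq_top_iff]
  rintro z -
  induction z using ind K with
  | hr r => exact S.algebraMap_mem r
  | hx => exact hx
  | hy => exact hy
  | hm a b h1 h2 => exact S.mul_mem h1 h2
  | ha a b h1 h2 => exact S.add_mem h1 h2

theorem comm_aeval (a : K[X]) : aeval (Wy K) a * Wx K - Wx K * aeval (Wy K) a =
    aeval (Wy K) (derivative a) := by
  apply cf_ext
  intro i j
  rw [cf_comm_x, cf, cf, sym_aeval_y, sym_aeval_y, coeff_C, coeff_C]
  split_ifs
  · rw [coeff_derivative, mul_comm]
  · simp

theorem main_gam {P Q : Weyl K} (h : Q * P - P * Q = 1) (hg : gam Q = -Q) : Gen P Q := by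
  obtain ⟨hP, hQ⟩ := charzero_main h hg
  have eQ : Q = aeval (Wy K) (uc Q 0) := by
    apply cf_ext
    intro i j
    rw [cf, cf, sym_aeval_y, coeff_C]
    split_ifs with hi
    · subst hi; rfl
    · by_contra hne
      exact hi (Nat.le_zero.1 (hQ i j (by simpa [cf] using hne)))
  have eP : P = Wx K * aeval (Wy K) (uc P 1) + aeval (Wy K) (uc P 0) := by
    apply cf_ext
    intro i j
    rw [cf_add]
    rcases i with _ | _ | i
    · rw [cf_x_mul_zero, cf, cf, sym_aeval_y, coeff_C]; simp [uc]
    · rw [cf_x_mul, cf, cf, cf, sym_aeval_y, sym_aeval_y, coeff_C, coeff_C]; simp [uc]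
    · rw [cf_x_mul, cf, cf, cf, sym_aeval_y, sym_aeval_y, coeff_C, coeff_C]
      simp only [Nat.add_eq_zero_iff, one_ne_zero, and_false, if_false, coeff_zero, add_zero]
      by_contra hne
      have := hP _ _ hne
      omega
  set φ := uc Q 0
  set a := uc P 1
  set b := uc P 0
  have e1 : aeval (Wy K) (derivative φ * a) = (1 : Weyl K) := by
    have c1 : aeval (Wy K) φ * aeval (Wy K) a = aeval (Wy K) a * aeval (Wy K) φ := by
      rw [← map_mul, ← map_mul, mul_comm]
    have c2 : aeval (Wy K) φ * aeval (Wy K) b = aeval (Wy K) b * aeval (Wy K) φ := by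
      rw [← map_mul, ← map_mul, mul_comm]
    rw [← h, eQ, eP, map_mul, ← comm_aeval, mul_add, add_mul, c2, sub_mul, add_sub_add_right_eq_sub,
      mul_assoc (Wx K), mul_assoc (Wx K), c1]
    simp only [mul_assoc]
  have e2 : derivative φ * a = 1 := by
    have := congrArg (sym K) e1
    rw [sym_aeval_y, sym_one, ← C_1] at this
    exact C_injective this
  have d1 := natDegree_eq_zero_of_isUnit (IsUnit.of_mul_eq_one _ e2)
  have d2 := natDegree_eq_zero_of_isUnit (IsUnit.of_mul_eq_one_right _ e2)
  obtain ⟨c, hc⟩ := natDegree_eq_zero.1 d2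
  have hc0 : c ≠ 0 := by
    rintro rfl
    rw [← hc] at e2
    simp at e2
  have hφ : φ = C (φ.coeff 0) + C (φ.coeff 1) * X := by
    ext n
    rcases n with _ | _ | n
    · simp
    · simp
    · have h1 : (derivative φ).coeff (n + 1) = 0 := coeff_eq_zero_of_natDegree_lt (by omega)
      rw [coeff_derivative] at h1
      have h2 : ((n + 1 : ℕ) : K) + 1 ≠ 0 := by exact_mod_cast Nat.succ_ne_zero (n + 1)
      rw [(mul_eq_zero.1 h1).resolve_right h2]
      simp [coeff_C, coeff_X]
  have hq : φ.coeff 1 ≠ 0 := by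
    intro h0
    rw [h0, C_0, zero_mul, add_zero] at hφ
    rw [hφ] at e2
    simp at e2
  intro S hPS hQS
  have hy : Wy K ∈ S := by
    have : Wy K = (φ.coeff 1)⁻¹ • (Q - algebraMap K _ (φ.coeff 0)) := by
      rw [eq_inv_smul_iff₀ hq, eq_sub_iff_add_eq, eQ]
      conv_rhs => rw [hφ]
      simp [Algebra.smul_def, add_comm]
    rw [this]
    exact S.smul_mem (S.sub_mem hQS (S.algebraMap_mem _)) _
  refine top_of_xy S ?_ hy
  have hb : aeval (Wy K) b ∈ S := by
    have := (aeval (⟨Wy K, hy⟩ : S) b).2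
    have h2 : S.val (aeval (⟨Wy K, hy⟩ : S) b) = aeval (Wy K) b := by
      rw [← aeval_algHom_apply]; rfl
    rw [← h2]; exact this
  have : Wx K = c⁻¹ • (P - aeval (Wy K) b) := by
    rw [eq_inv_smul_iff₀ hc0, eq_sub_iff_add_eq]
    conv_rhs => rw [eP]
    rw [← hc, aeval_C, Algebra.smul_def, Algebra.commutes]
  rw [this]
  exact S.smul_mem (S.sub_mem hPS hb) _

/-- every algebra endomorphism is injective -/
theorem endo_inj (F : Weyl K →ₐ[K] Weyl K) : Function.Injective F := by
  rw [injective_iff_map_eq_zero]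
  -- strong induction on total box size
  have key : ∀ n : ℕ, ∀ z : Weyl K, F z = 0 → (∀ i j, n ≤ i + j → cf K z i j = 0) → z = 0 := by
    intro n
    induction n with
    | zero =>
      intro z _ hz
      apply cf_ext
      intro i j
      rw [hz i j (Nat.zero_le _), cf_zero]
    | succ n ih =>
      intro z hz hb
      have h1 : Wy K * z - z * Wy K = 0 := by
        apply ih
        · rw [map_sub, map_mul, map_mul, hz]; simp
        · intro i j hij
          rw [cf_comm_y, hb _ _ (by omega), mul_zero]
      have h2 : z * Wx K - Wx K * z = 0 := by
        apply ih
        · rw [map_sub, map_mul, map_mul, hz]; simp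
        · intro i j hij
          rw [cf_comm_x, hb _ _ (by omega), mul_zero]
      have h3 : z = algebraMap K (Weyl K) (cf K z 0 0) := by
        apply cf_ext
        intro i j
        have e : algebraMap K (Weyl K) (cf K z 0 0) = cf K z 0 0 • (Wx K ^ 0 * Wy K ^ 0) := by
          rw [Algebra.smul_def]; simp
        rw [e, cf_smul, cf_mon]
        rcases i with _ | i
        · rcases j with _ | j
          · simp
          · have := cf_comm_x z 0 j
            rw [h2, cf_zero] at this
            have h0 : (j : K) + 1 ≠ 0 := by exact_mod_cast Nat.succ_ne_zero j
            rw [(mul_eq_zero.1 this.symm).resolve_left h0]; simp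
        · have := cf_comm_y z i j
          rw [h1, cf_zero] at this
          have h0 : (i : K) + 1 ≠ 0 := by exact_mod_cast Nat.succ_ne_zero i
          rw [(mul_eq_zero.1 this.symm).resolve_left h0]; simp
      rw [h3, AlgHom.commutes] at hz
      rw [h3, hz]
  intro z hz
  obtain ⟨D, hD⟩ := exists_bd z
  exact key (2 * D) z hz fun i j hij => hD i j (by omega)

theorem comm_x_mem {a : Weyl K} (h : a * Wx K - Wx K * a = 0) (S : Subalgebra K (Weyl K))
    (hx : Wx K ∈ S) : a ∈ S := by
  obtain ⟨D, hD⟩ := exists_bd a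
  rw [expand a D D hD]
  refine S.sum_mem fun i _ => S.sum_mem fun j _ => ?_
  rcases j with _ | j
  · rw [pow_zero, mul_one]
    exact S.smul_mem (S.pow_mem hx _) _
  · have := cf_comm_x a i j
    rw [h, cf_zero] at this
    have h0 : (j : K) + 1 ≠ 0 := by exact_mod_cast Nat.succ_ne_zero j
    rw [(mul_eq_zero.1 this.symm).resolve_left h0, zero_smul]
    exact S.zero_mem

theorem gen_change {P Q Q₀ : Weyl K} (h : Q * P - P * Q = 1) (h0 : Q₀ * P - P * Q₀ = 1)
    (hg : Gen P Q₀) : Gen P Q := by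
  intro S hP hQ
  apply hg S hP
  let G : Weyl K →ₐ[K] Weyl K := wlift P Q₀ (by rw [← h0]; abel)
  have gx : G (Wx K) = P := wlift_x ..
  have gy : G (Wy K) = Q₀ := wlift_y ..
  have hr : G.range = ⊤ := hg _ ⟨Wx K, gx⟩ ⟨Wy K, gy⟩
  obtain ⟨a, ha⟩ : Q - Q₀ ∈ G.range := by rw [hr]; trivial
  have ha' : G a = Q - Q₀ := ha
  have h1 : a * Wx K - Wx K * a = 0 := by
    apply endo_inj G
    rw [map_sub, map_mul, map_mul, gx, ha', map_zero, sub_mul, mul_sub, sub_sub_sub_comm, h, h0,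
      sub_self]
  have h2 : a ∈ S.comap G := comm_x_mem h1 _ (by
    change G (Wx K) ∈ S
    rw [gx]; exact hP)
  have h3 : Q - Q₀ ∈ S := by rw [← ha']; exact h2
  have := S.sub_mem hQ h3
  rwa [sub_sub_cancel] at this

variable {α : Weyl K → Weyl K}

theorem th_rel {T : Type} [Ring T] [Algebra K T] (x y : T) (h : y * x = x * y + 1) :
    ((2 : K)⁻¹ • (y - x)) * (x + y) = (x + y) * ((2 : K)⁻¹ • (y - x)) + 1 := by
  rw [smul_mul_assoc, mul_smul_comm]
  have : (y - x) * (x + y) = (x + y) * (y - x) + (2 : K) • (1 : T) := by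
    rw [two_smul, sub_mul, mul_add, mul_add, mul_sub, add_mul, add_mul, h]; abel
  rw [this, smul_add, smul_smul, inv_mul_cancel₀ two_ne_zero, one_smul]

theorem ps_rel {T : Type} [Ring T] [Algebra K T] (x y : T) (h : y * x = x * y + 1) :
    ((2 : K)⁻¹ • x + y) * ((2 : K)⁻¹ • x - y) = ((2 : K)⁻¹ • x - y) * ((2 : K)⁻¹ • x + y) + 1 := by
  have e : ∀ z : T, (z + y) * (z - y) = (z - y) * (z + y) + ((y * z - z * y) + (y * z - z * y)) := by
    intro z; noncomm_ring
  have e2 : y * ((2 : K)⁻¹ • x) - ((2 : K)⁻¹ • x) * y = (2 : K)⁻¹ • (1 : T) := by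
    rw [smul_mul_assoc, mul_smul_comm, ← smul_sub, h, add_sub_cancel_left]
  rw [e, e2, ← add_smul, ← two_mul, mul_inv_cancel₀ two_ne_zero, one_smul]

theorem neg_smul_help {T : Type} [Ring T] [Algebra K T] (z : T) : -z = (-1 : K) • z := by simp

theorem sub_smul_help {T : Type} [Ring T] [Algebra K T] (y z : T) : y - z = y + (-1 : K) • z := by
  simp [sub_eq_add_neg]

theorem smul_sub_help {T : Type} [Ring T] [Algebra K T] (c : K) (y z : T) :
    c • (y - z) = -(c • (z - y)) := by
  rw [← smul_neg, neg_sub]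

theorem comm_help {T : Type} [Ring T] [Algebra K T] (c : K) (a b p : T) :
    (c • (a - b)) * p - p * (c • (a - b)) = c • ((a * p - p * a) - (b * p - p * b)) := by
  rw [smul_mul_assoc, mul_smul_comm, ← smul_sub]
  congr 1
  noncomm_ring

theorem swap_help {T : Type} [Ring T] (p q : T) (h : q * p - p * q = 1) :
    p * (-q) - (-q) * p = 1 := by
  rw [← h]; noncomm_ring

theorem sub_neg_help {T : Type} [Ring T] (a : T) : a - -1 = a + 1 := by simp

theorem half_help {T : Type} [AddCommGroup T] [Module K T] (z : T) :
    (2 : K)⁻¹ • z + (2 : K)⁻¹ • z = z := by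
  rw [← add_smul, ← two_mul, mul_inv_cancel₀ two_ne_zero, one_smul]

theorem main_alpha (hα : IsExchange K α) {P Q : Weyl K} (h : Q * P - P * Q = 1)
    (hg : α Q = -Q) : Gen P Q := by
  obtain ⟨⟨⟨⟨aadd, asmul, amul, aone⟩, -⟩, ainv⟩, ax, ay⟩ := hα
  let θ : Weyl K →ₐ[K] Weyl K := wlift _ _ (th_rel (K := K) _ _ (wrel K))
  let ψ : Weyl K →ₐ[K] Weyl K := wlift _ _ (ps_rel (K := K) _ _ (wrel K))
  have tx : θ (Wx K) = Wx K + Wy K := wlift_x ..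
  have ty : θ (Wy K) = (2 : K)⁻¹ • (Wy K - Wx K) := wlift_y ..
  have px : ψ (Wx K) = (2 : K)⁻¹ • Wx K - Wy K := wlift_x ..
  have py : ψ (Wy K) = (2 : K)⁻¹ • Wx K + Wy K := wlift_y ..
  have tp : ∀ z, θ (ψ z) = z := by
    have : θ.comp ψ = AlgHom.id K _ := by
      apply whom_ext
      · simp only [AlgHom.comp_apply, px, AlgHom.id_apply]
        rw [map_sub, map_smul, tx, ty, smul_add, smul_sub]
        conv_rhs => rw [← half_help (K := K) (Wx K)]
        abel
      · simp only [AlgHom.comp_apply, py, AlgHom.id_apply]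
        rw [map_add, map_smul, tx, ty, smul_add, smul_sub]
        conv_rhs => rw [← half_help (K := K) (Wy K)]
        abel
    intro z
    exact DFunLike.congr_fun this z
  have asub : ∀ y z, α (y - z) = α y - α z := by
    intro y z
    have h1 : y - z = y + (-1 : K) • z := sub_smul_help _ _
    have h2 : α y - α z = α y + (-1 : K) • α z := sub_smul_help _ _
    rw [h1, h2, aadd, asmul]
  have at' : ∀ z, α (θ z) = θ (gam z) := by
    intro z
    induction z using ind K with
    | hr r => rw [gam_alg, AlgHom.commutes, Algebra.algebraMap_eq_smul_one, asmul, aone]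
    | hx => rw [tx, gam_x, tx, aadd, ax, ay, add_comm]
    | hy => rw [gam_y, map_neg, ty, asmul, asub, ax, ay]
            exact smul_sub_help _ _ _
    | hm a b h1 h2 => rw [map_mul, amul, gam_mul, map_mul, h1, h2]
    | ha a b h1 h2 => rw [map_add, aadd, gam_add, map_add, h1, h2]
  have q1 : gam (ψ Q) = -ψ Q := by
    apply endo_inj θ
    rw [← at', tp, hg, map_neg, tp]
  have q2 : ψ Q * ψ P - ψ P * ψ Q = 1 := by
    rw [← map_mul, ← map_mul, ← map_sub, h, map_one]
  have q3 := main_gam q2 q1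
  intro S hP hQ
  have h3 := q3 (S.comap θ) (by change θ (ψ P) ∈ S; rw [tp]; exact hP)
    (by change θ (ψ Q) ∈ S; rw [tp]; exact hQ)
  rw [eq_top_iff]
  rintro z -
  have : ψ z ∈ S.comap θ := by rw [h3]; trivial
  have : θ (ψ z) ∈ S := this
  rwa [tp] at this

theorem main_alpha_symm (hα : IsExchange K α) {P Q : Weyl K} (h : Q * P - P * Q = 1)
    (hg : α P = P) : Gen P Q := by
  have hα' := hα
  obtain ⟨⟨⟨⟨aadd, asmul, amul, aone⟩, -⟩, ainv⟩, ax, ay⟩ := hα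
  have aa : ∀ z, α (α z) = z := fun z => congrFun ainv z
  have asub : ∀ y z, α (y - z) = α y - α z := by
    intro y z
    have h1 : y - z = y + (-1 : K) • z := sub_smul_help _ _
    have h2 : α y - α z = α y + (-1 : K) • α z := sub_smul_help _ _
    rw [h1, h2, aadd, asmul]
  have h1 : α Q * P - P * α Q = -1 := by
    have := congrArg α h
    rw [asub, amul, amul, hg, aone] at this
    rw [← this]; abel
  have h0 : ((2 : K)⁻¹ • (Q - α Q)) * P - P * ((2 : K)⁻¹ • (Q - α Q)) = 1 := by
    have e1 := comm_help (K := K) (2 : K)⁻¹ Q (α Q) P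
    have e2 : (1 : Weyl K) - -1 = 1 + 1 := sub_neg_help _
    rw [h, h1, e2, smul_add, half_help] at e1
    exact e1
  refine gen_change h h0 (main_alpha hα' h0 ?_)
  rw [asmul, asub, aa]
  exact smul_sub_help _ _ _

theorem bij_of_gen (F : Weyl K →ₐ[K] Weyl K) (h : Gen (F (Wx K)) (F (Wy K))) :
    Function.Bijective F := by
  refine ⟨endo_inj F, ?_⟩
  have := h F.range ⟨_, rfl⟩ ⟨_, rfl⟩
  exact AlgHom.range_eq_top F |>.1 this

theorem gen_swap {P Q : Weyl K} (h : Gen (-Q) P) : Gen P Q :=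
  fun S hP hQ => h S (S.neg_mem hQ) hP

theorem final (hα : IsExchange K α) {f : Weyl K → Weyl K} (hf : IsAlgEndo K f)
    (hsym : α (f (Wx K)) = f (Wx K) ∨ α (f (Wx K)) = -f (Wx K) ∨
            α (f (Wy K)) = f (Wy K) ∨ α (f (Wy K)) = -f (Wy K)) : IsAlgAuto K f := by
  refine ⟨hf, ?_⟩
  obtain ⟨fadd, fsmul, fmul, fone⟩ := hf
  let F : Weyl K →ₐ[K] Weyl K := AlgHom.ofLinearMap ⟨⟨f, fadd⟩, fsmul⟩ fone fmul
  have h : f (Wy K) * f (Wx K) - f (Wx K) * f (Wy K) = 1 := by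
    rw [← fmul, wrel, fadd, fmul, fone]; abel
  have h' : f (Wx K) * (-f (Wy K)) - (-f (Wy K)) * f (Wx K) = 1  :=
    swap_help _ _ h
  suffices Gen (f (Wx K)) (f (Wy K)) from bij_of_gen F this
  rcases hsym with h1 | h1 | h1 | h1
  · exact main_alpha_symm hα h h1
  · exact gen_swap (main_alpha hα h' h1)
  · refine gen_swap (main_alpha_symm hα h' ?_)
    have e : ∀ z : Weyl K, -z = (-1 : K) • z := fun z => neg_smul_help z
    rw [e, hα.1.1.1.2.1, h1]
  · exact main_alpha hα h h1

end fin
end WW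

end

/-- if `P = f X` or `Q = f Y` is symmetric or skew-symmetric with respect
to the exchange involution `α`, then `f` is an automorphism. -/
theorem stmt_13 {K : Type} [Field K] [CharZero K]
    (α f : Weyl K → Weyl K) (hα : IsExchange K α) (hf : IsAlgEndo K f)
    (hsym : α (f (Wx K)) = f (Wx K) ∨ α (f (Wx K)) = -f (Wx K) ∨
            α (f (Wy K)) = f (Wy K) ∨ α (f (Wy K)) = -f (Wy K)) :
    IsAlgAuto K f := by
  exact WW.final hα hf hsym
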